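/- Let N≥2 and 1<q≤∞. If {u_k} is a bounded sequence in Ẇ^{1,1}(R^N) such that for every sequence {(j_k,y_k)}⊂Z×R^N one has g[j_k,y_k]u_k ⇀ 0 weakly in BV̇(R^N), then ‖u_k‖_{L^{1*,q}(R^N)} → 0; i.e., the embedding Ẇ^{1,1}(R^N) ↪ L^{1*,q}(R^N) is cocompact with respect to the group D. -/

import Mathlib

open MeasureTheory Set Filter Topology ENNReal

noncomputable section

abbrev Euc (N : ℕ) := EuclideanSpace ℝ (Fin N)

/-- Decreasing rearrangement of `u` with respect to Lebesgue measure on `ℝ^N`. -/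
def rearr (N : ℕ) (u : Euc N → ℝ) (t : ℝ) : ℝ :=
  sInf {l : ℝ | 0 < l ∧ volume {x : Euc N | l < |u x|} ≤ ENNReal.ofReal t}

/-- Lorentz quasinorm `‖u‖_{L^{p,q}}` on `ℝ^N` (with `q = ∞` allowed). -/
def lorentz (N : ℕ) (p : ℝ) (q : ℝ≥0∞) (u : Euc N → ℝ) : ℝ≥0∞ :=
  if q = ∞ then ⨆ t ∈ Ioi (0:ℝ), ENNReal.ofReal (t ^ (1/p) * rearr N u t)
  else (∫⁻ t in Ioi (0:ℝ),
      ENNReal.ofReal ((t ^ (1/p) * rearr N u t) ^ q.toReal / t)) ^ (1 / q.toReal)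

/-- Divergence of a vector field on `ℝ^N`. -/
def divg (N : ℕ) (v : Euc N → Euc N) (x : Euc N) : ℝ :=
  ∑ i : Fin N, fderiv ℝ v x (EuclideanSpace.single i 1) i

/-- Total variation `‖Du‖_Ω` of `u` over a set `Ω`. -/
def TV (N : ℕ) (u : Euc N → ℝ) (Ω : Set (Euc N)) : ℝ≥0∞ :=
  ⨆ (v : Euc N → Euc N) (_ : ContDiff ℝ (⊤ : ℕ∞) v) (_ : HasCompactSupport v)
    (_ : ∀ x, ‖v x‖ ≤ 1) (_ : tsupport v ⊆ Ω),
    ENNReal.ofReal (∫ x, u x * divg N v x)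

/-- `u` vanishes at infinity. -/
def VanishAtInfinity (N : ℕ) (u : Euc N → ℝ) : Prop :=
  ∀ M : ℝ, 0 < M → volume {x : Euc N | M < |u x|} < ∞

/-- Membership in `BV̇(ℝ^N)`. -/
def MemBVdot (N : ℕ) (u : Euc N → ℝ) : Prop :=
  Measurable u ∧ VanishAtInfinity N u ∧ TV N u univ < ∞

/-- The rescaling `g[j,y]u = 2^{(N-1)j} u (2^j (· - y))`. -/
def resc (N : ℕ) (j : ℤ) (y : Euc N) (u : Euc N → ℝ) : Euc N → ℝ :=
  fun x => (2:ℝ) ^ (((N:ℤ) - 1) * j) * u ((2:ℝ) ^ j • (x - y))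

/-- Weak convergence `u k ⇀ w` in `BV̇(ℝ^N)`. -/
def WeakBVconv (N : ℕ) (u : ℕ → Euc N → ℝ) (w : Euc N → ℝ) : Prop :=
  (∀ K : Set (Euc N), IsCompact K →
      Tendsto (fun k => ∫ x in K, |u k x - w x|) atTop (𝓝 0)) ∧
  ∀ i : Fin N, ∀ f : Euc N → ℝ, ContDiff ℝ (⊤ : ℕ∞) f → HasCompactSupport f →
      Tendsto (fun k => ∫ x, u k x * fderiv ℝ f x (EuclideanSpace.single i 1)) atTop
        (𝓝 (∫ x, w x * fderiv ℝ f x (EuclideanSpace.single i 1)))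

/-- `u` lies in `Ẇ^{1,1}(ℝ^N)` with distributional gradient `g ∈ L^1(ℝ^N; ℝ^N)`:
`u` is measurable, vanishes at infinity, `g` is integrable and for every test
function `f`, `∫ u ∂ᵢf = -∫ gᵢ f`. -/
def HasL1Gradient (N : ℕ) (u : Euc N → ℝ) (g : Euc N → Euc N) : Prop :=
  Measurable u ∧ VanishAtInfinity N u ∧ Integrable g ∧
  ∀ i : Fin N, ∀ f : Euc N → ℝ, ContDiff ℝ (⊤ : ℕ∞) f → HasCompactSupport f →
    ∫ x, u x * fderiv ℝ f x (EuclideanSpace.single i 1) = -∫ x, g x i * f x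

open scoped Convolution

section Mollification

variable {N : ℕ} {u : Euc N → ℝ} {g : Euc N → Euc N}

theorem fderiv_mollification_apply (hu : LocallyIntegrable u) (hg : Integrable g)
    (hug : ∀ i : Fin N, ∀ f : Euc N → ℝ, ContDiff ℝ (⊤ : ℕ∞) f → HasCompactSupport f →
      ∫ x, u x * fderiv ℝ f x (EuclideanSpace.single i 1) = -∫ x, g x i * f x)
    (ρ : ContDiffBump (0 : Euc N)) (x : Euc N) (i : Fin N) :
    fderiv ℝ (ρ.normed volume ⋆[ContinuousLinearMap.lsmul ℝ ℝ, volume] u) x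
        (EuclideanSpace.single i 1)
      = (ρ.normed volume ⋆[ContinuousLinearMap.lsmul ℝ ℝ, volume] g) x i := by
  have hc : HasCompactSupport (ρ.normed (volume : Measure (Euc N))) := ρ.hasCompactSupport_normed
  have hs : ContDiff ℝ (⊤ : ℕ∞) (ρ.normed (volume : Measure (Euc N))) := ρ.contDiff_normed
  have hs1 : ContDiff ℝ 1 (ρ.normed (volume : Measure (Euc N))) := ρ.contDiff_normed
  rw [(hc.hasFDerivAt_convolution_left (ContinuousLinearMap.lsmul ℝ ℝ) hs1 hu x).fderiv]
  have hint : Integrable (fun t => ((ContinuousLinearMap.lsmul ℝ ℝ).precompL (Euc N)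
      (fderiv ℝ (ρ.normed (volume : Measure (Euc N))) t)) (u (x - t))) :=
    (HasCompactSupport.convolutionExists_left
      (L := (ContinuousLinearMap.lsmul ℝ ℝ : ℝ →L[ℝ] ℝ →L[ℝ] ℝ).precompL (Euc N))
      (hc.fderiv ℝ) (hs1.continuous_fderiv one_ne_zero) hu) x
  rw [convolution_def, ContinuousLinearMap.integral_apply hint]
  have hintg : Integrable (fun t => ρ.normed (volume : Measure (Euc N)) t • g (x - t)) :=
    (HasCompactSupport.convolutionExists_left
      (L := (ContinuousLinearMap.lsmul ℝ ℝ : ℝ →L[ℝ] Euc N →L[ℝ] Euc N))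
      hc hs1.continuous hg.locallyIntegrable) x
  have h2 : (ρ.normed volume ⋆[ContinuousLinearMap.lsmul ℝ ℝ, volume] g) x i
      = ∫ t, ρ.normed volume (x - t) * g t i := by
    rw [convolution_def]
    have := (EuclideanSpace.proj (𝕜 := ℝ) i : Euc N →L[ℝ] ℝ).integral_comp_comm hintg
    simp only [PiLp.proj_apply] at this
    simp only [ContinuousLinearMap.lsmul_apply]
    rw [← this, ← integral_sub_left_eq_self _ _ x]
    simp
  have hf1 : ContDiff ℝ (⊤ : ℕ∞) (fun t => ρ.normed (volume : Measure (Euc N)) (x - t)) :=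
    hs.comp (contDiff_const.sub contDiff_id)
  have hf2 : HasCompactSupport (fun t => ρ.normed (volume : Measure (Euc N)) (x - t)) :=
    hc.comp_homeomorph (Homeomorph.subLeft x)
  have h3 := hug i _ hf1 hf2
  have h4 : ∀ t, fderiv ℝ (fun t => ρ.normed (volume : Measure (Euc N)) (x - t)) t
      (EuclideanSpace.single i 1) = - fderiv ℝ (ρ.normed (volume : Measure (Euc N))) (x - t)
        (EuclideanSpace.single i 1) := by
    intro t
    have hd : HasFDerivAt (fun t : Euc N => x - t) (-ContinuousLinearMap.id ℝ (Euc N)) t := by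
      simpa using (hasFDerivAt_id t).const_sub x
    have := ((hs1.differentiable one_ne_zero (x - t)).hasFDerivAt.comp t hd).fderiv
    have e : (ρ.normed (volume : Measure (Euc N)) ∘ fun t => x - t)
      = fun t => ρ.normed (volume : Measure (Euc N)) (x - t) := rfl
    rw [e] at this
    rw [this]; simp
  rw [h2, ← integral_sub_left_eq_self _ _ x]
  simp only [h4] at h3
  simp only [mul_neg, integral_neg, neg_inj] at h3
  simp only [_root_.sub_sub_cancel]
  rw [integral_congr_ae (g := fun t => u t * fderiv ℝ (ρ.normed (volume : Measure (Euc N))) (x - t)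
        (EuclideanSpace.single i 1)), h3]
  · simp only [mul_comm]
  · filter_upwards with t
    simp [ContinuousLinearMap.precompL_apply, mul_comm]

theorem enorm_fderiv_mollification_le (hu : LocallyIntegrable u) (hg : Integrable g)
    (hug : ∀ i : Fin N, ∀ f : Euc N → ℝ, ContDiff ℝ (⊤ : ℕ∞) f → HasCompactSupport f →
      ∫ x, u x * fderiv ℝ f x (EuclideanSpace.single i 1) = -∫ x, g x i * f x)
    (ρ : ContDiffBump (0 : Euc N)) (x : Euc N) :
    ‖fderiv ℝ (ρ.normed volume ⋆[ContinuousLinearMap.lsmul ℝ ℝ, volume] u) x‖ₑ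
      ≤ ‖(ρ.normed volume ⋆[ContinuousLinearMap.lsmul ℝ ℝ, volume] g) x‖ₑ := by
  have : fderiv ℝ (ρ.normed volume ⋆[ContinuousLinearMap.lsmul ℝ ℝ, volume] u) x
      = innerSL ℝ ((ρ.normed volume ⋆[ContinuousLinearMap.lsmul ℝ ℝ, volume] g) x) := by
    apply ContinuousLinearMap.coe_injective
    apply (EuclideanSpace.basisFun (Fin N) ℝ).toBasis.ext
    intro i
    simpa [EuclideanSpace.inner_single_right] using fderiv_mollification_apply hu hg hug ρ x i
  rw [this, enorm_le_iff_norm_le, innerSL_apply_norm]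

theorem lintegral_enorm_mollification_le (hg : Integrable g) (ρ : ContDiffBump (0 : Euc N)) :
    ∫⁻ x, ‖(ρ.normed volume ⋆[ContinuousLinearMap.lsmul ℝ ℝ, volume] g) x‖ₑ ≤ ∫⁻ x, ‖g x‖ₑ := by
  have hρc : Continuous (ρ.normed (volume : Measure (Euc N))) := ρ.continuous_normed
  calc _ ≤ ∫⁻ x, ∫⁻ t, ‖ρ.normed volume t‖ₑ * ‖g (x - t)‖ₑ := by
        gcongr with x
        rw [convolution_def]
        refine (enorm_integral_le_lintegral_enorm _).trans (lintegral_mono fun t => ?_)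
        simp [enorm_smul]
    _ = ∫⁻ t, ∫⁻ x, ‖ρ.normed volume t‖ₑ * ‖g (x - t)‖ₑ := by
        rw [lintegral_lintegral_swap]
        have h1 : AEStronglyMeasurable (fun p : Euc N × Euc N => g (p.1 - p.2))
            (volume.prod volume) := by
          exact hg.1.comp_quasiMeasurePreserving (quasiMeasurePreserving_sub volume volume)
        exact ((hρc.comp continuous_snd).aestronglyMeasurable.enorm).mul h1.enorm
    _ = ∫⁻ t, ‖ρ.normed volume t‖ₑ * ∫⁻ x, ‖g x‖ₑ := by
        congr with t
        rw [lintegral_const_mul' _ _ enorm_ne_top, lintegral_sub_right_eq_self (fun x => ‖g x‖ₑ) t]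
    _ = (∫⁻ t, ‖ρ.normed volume t‖ₑ) * ∫⁻ x, ‖g x‖ₑ := by
        rw [lintegral_mul_const _ hρc.enorm.measurable]
    _ = _ := by
        have : ∫⁻ t, ‖ρ.normed (volume : Measure (Euc N)) t‖ₑ = 1 := by
          rw [← ofReal_integral_norm_eq_lintegral_enorm ρ.integrable_normed]
          simp only [Real.norm_eq_abs, abs_of_nonneg (ρ.nonneg_normed _)]
          rw [ρ.integral_normed]; simp
        rw [this, one_mul]

end Mollification

theorem limsup_add_le_ennreal (a b : ℕ → ℝ≥0∞) :
    limsup (fun n => a n + b n) atTop ≤ limsup a atTop + limsup b atTop := by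
  refine ENNReal.le_of_forall_pos_le_add fun ε hε hfin => ?_
  have hε2 : (ε / 2 : ℝ≥0∞) ≠ 0 := by simpa using hε.ne'
  have ha := eventually_lt_of_limsup_lt
    (ENNReal.lt_add_right (ne_top_of_le_ne_top hfin.ne le_self_add) hε2)
  have hb := eventually_lt_of_limsup_lt
    (ENNReal.lt_add_right (ne_top_of_le_ne_top hfin.ne le_add_self) hε2)
  refine limsup_le_of_le (by isBoundedDefault) ?_
  filter_upwards [ha, hb] with n h1 h2
  refine (add_le_add h1.le h2.le).trans (le_of_eq ?_)
  rw [add_add_add_comm, ENNReal.add_halves]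

theorem limsup_lintegral_mul_le {α : Type*} [MeasurableSpace α] {μ : Measure α}
    {w F : ℕ → α → ℝ≥0∞} {w₀ F₀ : α → ℝ≥0∞} {c : ℝ≥0∞} (hc : c ≠ ∞)
    (hw : ∀ n, Measurable (w n)) (hF : ∀ n, AEMeasurable (F n) μ)
    (hw₀ : Measurable w₀)
    (hF₀ : AEMeasurable F₀ μ) (hwc : ∀ n x, w n x ≤ c) (hw₀c : ∀ x, w₀ x ≤ c)
    (hwlim : ∀ᵐ x ∂μ, Tendsto (fun n => w n x) atTop (𝓝 (w₀ x)))
    (hFlim : ∀ᵐ x ∂μ, Tendsto (fun n => F n x) atTop (𝓝 (F₀ x)))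
    (hFfin : ∀ᵐ x ∂μ, F₀ x ≠ ∞)
    (hle : ∀ n, ∫⁻ x, F n x ∂μ ≤ ∫⁻ x, F₀ x ∂μ) (hfin : ∫⁻ x, F₀ x ∂μ ≠ ∞) :
    limsup (fun n => ∫⁻ x, w n x * F n x ∂μ) atTop ≤ ∫⁻ x, w₀ x * F₀ x ∂μ := by
  set T := c * ∫⁻ x, F₀ x ∂μ with hT
  have hTfin : T ≠ ∞ := ENNReal.mul_ne_top hc hfin
  have split : ∀ (v G : α → ℝ≥0∞), Measurable v → AEMeasurable G μ → (∀ x, v x ≤ c) →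
      (∫⁻ x, v x * G x ∂μ) + (∫⁻ x, (c - v x) * G x ∂μ) = c * ∫⁻ x, G x ∂μ := by
    intro v G hv hG hvc
    have hvG : AEMeasurable (fun x => v x * G x) μ := hv.aemeasurable.mul hG
    rw [← lintegral_add_left' hvG, ← lintegral_const_mul' _ _ hc]
    congr with x
    rw [← add_mul, add_tsub_cancel_of_le (hvc x)]
  have h0 := split w₀ F₀ hw₀ hF₀ hw₀c
  have ha : ∫⁻ x, (c - w₀ x) * F₀ x ∂μ ≠ ∞ :=
    ne_top_of_le_ne_top hTfin (le_add_self.trans h0.le)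
  have hlim : ∫⁻ x, (c - w₀ x) * F₀ x ∂μ
      ≤ liminf (fun n => ∫⁻ x, (c - w n x) * F n x ∂μ) atTop := by
    refine le_trans ?_ (lintegral_liminf_le' fun n =>
      ((measurable_const.sub (hw n)).aemeasurable.mul (hF n)))
    refine lintegral_mono_ae ?_
    filter_upwards [hwlim, hFlim, hFfin] with x h1 h2 h3
    have h4 : Tendsto (fun n => (c - w n x)) atTop (𝓝 (c - w₀ x)) :=
      ENNReal.Tendsto.sub tendsto_const_nhds h1 (Or.inl hc)
    exact (ENNReal.Tendsto.mul h4 (Or.inr h3) h2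
      (Or.inr (ne_top_of_le_ne_top hc tsub_le_self))).liminf_eq.ge
  calc limsup (fun n => ∫⁻ x, w n x * F n x ∂μ) atTop
      ≤ limsup (fun n => T - ∫⁻ x, (c - w n x) * F n x ∂μ) atTop := by
        refine limsup_le_limsup (Eventually.of_forall fun n => ?_)
        have h1 := split (w n) (F n) (hw n) (hF n) (hwc n)
        have h2 : c * ∫⁻ x, F n x ∂μ ≤ T := by exact mul_le_mul_right (hle n) c
        refine ENNReal.le_sub_of_add_le_right ?_ (h1.trans_le h2)
        exact ne_top_of_le_ne_top (ne_top_of_le_ne_top hTfin h2) (le_add_self.trans h1.le)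
    _ = T - liminf (fun n => ∫⁻ x, (c - w n x) * F n x ∂μ) atTop :=
        ENNReal.limsup_const_sub _ _ hTfin
    _ ≤ T - ∫⁻ x, (c - w₀ x) * F₀ x ∂μ := by gcongr
    _ = ∫⁻ x, w₀ x * F₀ x ∂μ := by rw [hT, ← h0, ENNReal.add_sub_cancel_right ha]

/-- Sobolev constant in `∫ |f|^p ≤ C (∫ |∇f|)^p`, `p = N/(N-1)`. -/
def gnsConst (N : ℕ) : ℝ≥0∞ :=
  (lintegralPowLePowLIntegralFDerivConst (volume : Measure (Euc N))
    ((N : ℝ) / ((N : ℝ) - 1)) : NNReal)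

theorem gnsConst_ne_top (N : ℕ) : gnsConst N ≠ ∞ := coe_ne_top

theorem holderConjugate_critical {N : ℕ} (hN : 2 ≤ N) :
    Real.HolderConjugate (N : ℝ) ((N : ℝ) / ((N : ℝ) - 1)) :=
  Real.HolderConjugate.conjExponent (by exact_mod_cast hN)

/-- Sobolev inequality for a smooth function after a change of values and a cutoff. -/
theorem gns_comp_mul {N : ℕ} (hN : 2 ≤ N) {U : Euc N → ℝ} (hU : ContDiff ℝ 1 U)
    {φ : ℝ → ℝ} (hφ : ContDiff ℝ 1 φ) {ψ : Euc N → ℝ} (hψ : ContDiff ℝ 1 ψ)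
    (hψc : HasCompactSupport ψ) {V : Euc N → Euc N} (hV : Continuous V)
    (hUV : ∀ x, ‖fderiv ℝ U x‖ₑ ≤ ‖V x‖ₑ) :
    ∫⁻ x, ‖ψ x * φ (U x)‖ₑ ^ ((N : ℝ) / ((N : ℝ) - 1)) ≤
      gnsConst N * ((∫⁻ x, (‖ψ x‖ₑ * ‖deriv φ (U x)‖ₑ) * ‖V x‖ₑ)
        + ∫⁻ x, ‖φ (U x)‖ₑ * ‖fderiv ℝ ψ x‖ₑ) ^ ((N : ℝ) / ((N : ℝ) - 1)) := by
  have hp : Real.HolderConjugate (Module.finrank ℝ (Euc N)) ((N : ℝ) / ((N : ℝ) - 1)) := by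
    rw [finrank_euclideanSpace_fin]; exact holderConjugate_critical hN
  have h1 : ContDiff ℝ 1 (fun x => ψ x * φ (U x)) := hψ.mul (hφ.comp hU)
  have h2 : HasCompactSupport (fun x => ψ x * φ (U x)) := hψc.mul_right
  refine (lintegral_pow_le_pow_lintegral_fderiv volume h1 h2 hp).trans ?_
  unfold gnsConst
  have hp0 := hp.symm.nonneg
  gcongr
  have hmeas : Measurable fun x => (‖ψ x‖ₑ * ‖deriv φ (U x)‖ₑ) * ‖V x‖ₑ := by
    have := hφ.continuous_deriv le_rfl
    have := (this.comp hU.continuous).enorm.measurable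
    exact (hψ.continuous.enorm.measurable.mul this).mul hV.enorm.measurable
  rw [← lintegral_add_left hmeas]
  gcongr with x
  have hd : HasFDerivAt (fun x => ψ x * φ (U x))
      (ψ x • (deriv φ (U x) • fderiv ℝ U x) + φ (U x) • fderiv ℝ ψ x) x :=
    (hψ.differentiable one_ne_zero x).hasFDerivAt.mul
      ((hφ.differentiable one_ne_zero (U x)).hasDerivAt.comp_hasFDerivAt x
        (hU.differentiable one_ne_zero x).hasFDerivAt)
  rw [hd.fderiv]
  calc ‖ψ x • (deriv φ (U x) • fderiv ℝ U x) + φ (U x) • fderiv ℝ ψ x‖ₑ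
      ≤ ‖ψ x • (deriv φ (U x) • fderiv ℝ U x)‖ₑ + ‖φ (U x) • fderiv ℝ ψ x‖ₑ :=
        enorm_add_le (E := Euc N →L[ℝ] ℝ) _ _
    _ = (‖ψ x‖ₑ * ‖deriv φ (U x)‖ₑ) * ‖fderiv ℝ U x‖ₑ + ‖φ (U x)‖ₑ * ‖fderiv ℝ ψ x‖ₑ := by
        rw [enorm_smul, enorm_smul, enorm_smul, ← mul_assoc]
    _ ≤ _ := by gcongr; exact hUV x

/-- Localised Sobolev inequality for a smooth bounded function of a weakly differentiable
function. -/
theorem sobolev_comp_mul {N : ℕ} (hN : 2 ≤ N) {u : Euc N → ℝ} {g : Euc N → Euc N}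
    (hum : Measurable u) (hu : LocallyIntegrable u) (hg : Integrable g)
    (hug : ∀ i : Fin N, ∀ f : Euc N → ℝ, ContDiff ℝ (⊤ : ℕ∞) f → HasCompactSupport f →
      ∫ x, u x * fderiv ℝ f x (EuclideanSpace.single i 1) = -∫ x, g x i * f x)
    {φ : ℝ → ℝ} (hφ : ContDiff ℝ 1 φ) {B : ℝ≥0∞} (hB : B ≠ ∞) (hφB : ∀ t, ‖φ t‖ₑ ≤ B)
    (hφB' : ∀ t, ‖deriv φ t‖ₑ ≤ B) {ψ : Euc N → ℝ} (hψ : ContDiff ℝ 1 ψ)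
    (hψc : HasCompactSupport ψ) :
    ∫⁻ x, ‖ψ x * φ (u x)‖ₑ ^ ((N : ℝ) / ((N : ℝ) - 1)) ≤
      gnsConst N * ((∫⁻ x, (‖ψ x‖ₑ * ‖deriv φ (u x)‖ₑ) * ‖g x‖ₑ)
        + ∫⁻ x, ‖φ (u x)‖ₑ * ‖fderiv ℝ ψ x‖ₑ) ^ ((N : ℝ) / ((N : ℝ) - 1)) := by
  set p := (N : ℝ) / ((N : ℝ) - 1) with hpdef
  have hp0 : 0 ≤ p := (holderConjugate_critical hN).symm.nonneg
  let ρ : ℕ → ContDiffBump (0 : Euc N) := fun n =>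
    { rIn := 1 / ((n : ℝ) + 1)
      rOut := 2 * (1 / ((n : ℝ) + 1))
      rIn_pos := Nat.one_div_pos_of_nat
      rIn_lt_rOut := by
        have : (0 : ℝ) < 1 / ((n : ℝ) + 1) := Nat.one_div_pos_of_nat
        linarith }
  have hρ1 : Tendsto (fun n => (ρ n).rOut) atTop (𝓝 0) := by
    have := (tendsto_one_div_add_atTop_nhds_zero_nat (𝕜 := ℝ)).const_mul 2
    rwa [mul_zero] at this
  have hρ2 : ∀ᶠ n in atTop, (ρ n).rOut ≤ 2 * (ρ n).rIn := Eventually.of_forall fun n => le_rfl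
  set U : ℕ → Euc N → ℝ := fun n =>
    ((ρ n).normed volume ⋆[ContinuousLinearMap.lsmul ℝ ℝ, volume] u) with hUdef
  set V : ℕ → Euc N → Euc N := fun n =>
    ((ρ n).normed volume ⋆[ContinuousLinearMap.lsmul ℝ ℝ, volume] g) with hVdef
  have hUlim := ContDiffBump.ae_convolution_tendsto_right_of_locallyIntegrable
    (μ := (volume : Measure (Euc N))) hρ1 hρ2 hu
  have hVlim := ContDiffBump.ae_convolution_tendsto_right_of_locallyIntegrable
    (μ := (volume : Measure (Euc N))) hρ1 hρ2 hg.locallyIntegrable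
  have hUc : ∀ n, ContDiff ℝ 1 (U n) := fun n =>
    ((ρ n).hasCompactSupport_normed).contDiff_convolution_left (n := 1) _
      ((ρ n).contDiff_normed) hu
  have hVc : ∀ n, Continuous (V n) := fun n =>
    (((ρ n).hasCompactSupport_normed).contDiff_convolution_left (n := 0) _
      ((ρ n).contDiff_normed) hg.locallyIntegrable).continuous
  have hstep := fun n => gns_comp_mul hN (hUc n) hφ hψ hψc (hVc n)
    (enorm_fderiv_mollification_le hu hg hug (ρ n))
  have hφ'c : Continuous (deriv φ) := hφ.continuous_deriv le_rfl
  obtain ⟨M, hM⟩ := hψc.exists_bound_of_continuous hψ.continuous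
  have hH : limsup (fun n => ∫⁻ x, (‖ψ x‖ₑ * ‖deriv φ (U n x)‖ₑ) * ‖V n x‖ₑ) atTop
      ≤ ∫⁻ x, (‖ψ x‖ₑ * ‖deriv φ (u x)‖ₑ) * ‖g x‖ₑ := by
    have hMe : ∀ x, ‖ψ x‖ₑ ≤ ENNReal.ofReal M := fun x => by
      rw [← ofReal_norm]; exact ENNReal.ofReal_le_ofReal (hM x)
    refine limsup_lintegral_mul_le (c := ENNReal.ofReal M * B)
      (ENNReal.mul_ne_top ofReal_ne_top hB)
      (fun n => hψ.continuous.enorm.measurable.mul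
        (hφ'c.comp (hUc n).continuous).enorm.measurable)
      (fun n => (hVc n).enorm.aemeasurable)
      (hψ.continuous.enorm.measurable.mul (hφ'c.measurable.comp hum).enorm)
      hg.1.enorm (fun n x => mul_le_mul' (hMe x) (hφB' _)) (fun x => mul_le_mul' (hMe x) (hφB' _))
      ?_ ?_ (Eventually.of_forall fun x => enorm_ne_top)
      (fun n => lintegral_enorm_mollification_le hg (ρ n)) hg.2.ne
    · filter_upwards [hUlim] with x hx
      exact ENNReal.Tendsto.const_mul ((hφ'c.tendsto _).comp hx).enorm (Or.inr enorm_ne_top)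
    · filter_upwards [hVlim] with x hx using hx.enorm
  have hE : limsup (fun n => ∫⁻ x, ‖φ (U n x)‖ₑ * ‖fderiv ℝ ψ x‖ₑ) atTop
      ≤ ∫⁻ x, ‖φ (u x)‖ₑ * ‖fderiv ℝ ψ x‖ₑ := by
    have hc := hψ.continuous_fderiv one_ne_zero
    have hi : Integrable (fderiv ℝ ψ) := hc.integrable_of_hasCompactSupport (hψc.fderiv ℝ)
    refine limsup_lintegral_mul_le (F := fun _ x => ‖fderiv ℝ ψ x‖ₑ) hB
      (fun n => (hφ.continuous.comp (hUc n).continuous).enorm.measurable)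
      (fun n => hc.enorm.aemeasurable) (hφ.continuous.measurable.comp hum).enorm
      hc.enorm.aemeasurable (fun n x => hφB _) (fun x => hφB _) ?_
      (Eventually.of_forall fun x => tendsto_const_nhds)
      (Eventually.of_forall fun x => enorm_ne_top) (fun n => le_rfl) hi.2.ne
    filter_upwards [hUlim] with x hx
    exact ((hφ.continuous.tendsto _).comp hx).enorm
  set R : ℕ → ℝ≥0∞ := fun n => (∫⁻ x, (‖ψ x‖ₑ * ‖deriv φ (U n x)‖ₑ) * ‖V n x‖ₑ)
        + ∫⁻ x, ‖φ (U n x)‖ₑ * ‖fderiv ℝ ψ x‖ₑ with hR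
  have hRlim : limsup R atTop ≤ (∫⁻ x, (‖ψ x‖ₑ * ‖deriv φ (u x)‖ₑ) * ‖g x‖ₑ)
        + ∫⁻ x, ‖φ (u x)‖ₑ * ‖fderiv ℝ ψ x‖ₑ :=
    (limsup_add_le_ennreal _ _).trans (add_le_add hH hE)
  have hmono : Monotone fun b : ℝ≥0∞ => gnsConst N * b ^ p := fun a b h => by
    dsimp only; gcongr
  have hcont : Continuous fun b : ℝ≥0∞ => gnsConst N * b ^ p :=
    (ENNReal.continuous_const_mul (gnsConst_ne_top N)).comp (ENNReal.continuous_rpow_const)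
  calc ∫⁻ x, ‖ψ x * φ (u x)‖ₑ ^ p
      ≤ ∫⁻ x, liminf (fun n => ‖ψ x * φ (U n x)‖ₑ ^ p) atTop := by
        refine lintegral_mono_ae ?_
        filter_upwards [hUlim] with x hx
        refine (Tendsto.liminf_eq ?_).ge
        exact (ENNReal.continuous_rpow_const.tendsto _).comp
          (((hφ.continuous.tendsto _).comp hx).const_mul _).enorm
    _ ≤ liminf (fun n => ∫⁻ x, ‖ψ x * φ (U n x)‖ₑ ^ p) atTop :=
        lintegral_liminf_le fun n => (ENNReal.continuous_rpow_const.comp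
          (hψ.continuous.mul (hφ.continuous.comp (hUc n).continuous)).enorm).measurable
    _ ≤ limsup (fun n => ∫⁻ x, ‖ψ x * φ (U n x)‖ₑ ^ p) atTop := liminf_le_limsup
    _ ≤ limsup ((fun b : ℝ≥0∞ => gnsConst N * b ^ p) ∘ R) atTop :=
        limsup_le_limsup (Eventually.of_forall hstep)
    _ = gnsConst N * (limsup R atTop) ^ p :=
        (hmono.map_limsup_of_continuousAt R hcont.continuousAt).symm
    _ ≤ _ := hmono hRlim

/-- A smooth cutoff of values, vanishing on `[-1,1]` and equal to `1` outside `(-l,l)`. -/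
structure IsLevelCutoff (l : ℝ) (B : ℝ≥0∞) (φ : ℝ → ℝ) : Prop where
  contDiff : ContDiff ℝ 1 φ
  nonneg : ∀ t, 0 ≤ φ t
  le_one : ∀ t, φ t ≤ 1
  eq_zero : ∀ t, |t| ≤ 1 → φ t = 0
  eq_one : ∀ t, l ≤ |t| → φ t = 1
  deriv_eq_zero : ∀ t, (|t| ≤ 1 ∨ l ≤ |t|) → deriv φ t = 0
  deriv_le : ∀ t, ‖deriv φ t‖ₑ ≤ B
  bound_ne_top : B ≠ ∞

theorem exists_isLevelCutoff {l : ℝ} (hl : 1 < l) : ∃ B φ, IsLevelCutoff l B φ := by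
  set φ : ℝ → ℝ := fun t => Real.smoothTransition ((t ^ 2 - 1) / (l ^ 2 - 1)) with hφ
  have hl2 : 0 < l ^ 2 - 1 := by nlinarith
  have hs : ContDiff ℝ 1 φ :=
    Real.smoothTransition.contDiff.comp (((contDiff_id.pow 2).sub contDiff_const).div_const _)
  have h0 : ∀ t, 0 ≤ φ t := fun t => Real.smoothTransition.nonneg _
  have h1 : ∀ t, φ t ≤ 1 := fun t => Real.smoothTransition.le_one _
  have hz : ∀ t, |t| ≤ 1 → φ t = 0 := fun t ht => by
    apply Real.smoothTransition.zero_of_nonpos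
    apply div_nonpos_of_nonpos_of_nonneg _ hl2.le
    have := (sq_le_one_iff_abs_le_one t).2 ht
    linarith
  have ho : ∀ t, l ≤ |t| → φ t = 1 := fun t ht => by
    apply Real.smoothTransition.one_of_one_le
    rw [le_div_iff₀ hl2]
    have : l ^ 2 ≤ t ^ 2 := by
      rw [← sq_abs t]; exact pow_le_pow_left₀ (by linarith) ht 2
    linarith
  have hd : ∀ t, (|t| ≤ 1 ∨ l ≤ |t|) → deriv φ t = 0 := by
    rintro t (ht | ht)
    · exact IsLocalMin.deriv_eq_zero (Eventually.of_forall fun x => by rw [hz t ht]; exact h0 x)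
    · exact IsLocalMax.deriv_eq_zero (Eventually.of_forall fun x => by rw [ho t ht]; exact h1 x)
  have hcs : HasCompactSupport (deriv φ) := by
    refine HasCompactSupport.intro (isCompact_Icc (a := -l) (b := l)) fun t ht => hd t (Or.inr ?_)
    by_contra! h
    exact ht (abs_le.1 h.le)
  obtain ⟨M, hM⟩ := hcs.exists_bound_of_continuous (hs.continuous_deriv le_rfl)
  refine ⟨ENNReal.ofReal M, φ, hs, h0, h1, hz, ho, hd, fun t => ?_, ofReal_ne_top⟩
  rw [← ofReal_norm]
  exact ENNReal.ofReal_le_ofReal (hM t)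

namespace IsLevelCutoff

variable {l : ℝ} {B : ℝ≥0∞} {φ : ℝ → ℝ}

theorem le_abs (h : IsLevelCutoff l B φ) (t : ℝ) : φ t ≤ |t| := by
  rcases le_total |t| 1 with ht | ht
  · rw [h.eq_zero t ht]; positivity
  · exact (h.le_one t).trans ht

theorem contDiff_scaled (h : IsLevelCutoff l B φ) (s : ℝ) :
    ContDiff ℝ 1 (fun t => s * φ (s⁻¹ * t)) :=
  contDiff_const.mul (h.contDiff.comp (contDiff_const.mul contDiff_id))

theorem deriv_scaled (h : IsLevelCutoff l B φ) {s : ℝ} (hs : 0 < s) (t : ℝ) :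
    deriv (fun t => s * φ (s⁻¹ * t)) t = deriv φ (s⁻¹ * t) := by
  have h1 : HasDerivAt (fun t => s⁻¹ * t) s⁻¹ t := by
    simpa using (hasDerivAt_id t).const_mul s⁻¹
  have := (((h.contDiff.differentiable one_ne_zero (s⁻¹ * t)).hasDerivAt.comp t h1).const_mul
    s).deriv
  rw [show (fun t => s * φ (s⁻¹ * t)) = (fun y => s * (φ ∘ fun t => s⁻¹ * t) y) from rfl, this]
  field_simp

theorem enorm_scaled_le (h : IsLevelCutoff l B φ) {s : ℝ} (t : ℝ) :
    ‖s * φ (s⁻¹ * t)‖ₑ ≤ ‖s‖ₑ := by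
  rw [enorm_mul]
  refine mul_le_of_le_one_right' ?_
  rw [← ofReal_norm, Real.norm_of_nonneg (h.nonneg _)]
  exact ofReal_le_one.2 (h.le_one _)

theorem enorm_scaled_le_indicator (h : IsLevelCutoff l B φ) {s : ℝ} (hs : 0 < s) {α : Type*}
    (u : α → ℝ) (x : α) :
    ‖s * φ (s⁻¹ * u x)‖ₑ ≤ {x | s < |u x|}.indicator (fun _ => ENNReal.ofReal s) x := by
  by_cases hx : s < |u x|
  · rw [indicator_of_mem (by exact hx)]
    refine (h.enorm_scaled_le _).trans ?_
    rw [← ofReal_norm, Real.norm_of_nonneg hs.le]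
  · have : |s⁻¹ * u x| ≤ 1 := by
      rw [abs_mul, abs_of_pos (inv_pos.2 hs), inv_mul_le_iff₀ hs]; simpa using hx
    rw [h.eq_zero _ this]; simp

theorem lintegral_scaled_le (h : IsLevelCutoff l B φ) {s : ℝ} (hs : 0 < s) {α : Type*}
    [MeasurableSpace α] {μ : Measure α} {u : α → ℝ} (hu : Measurable u) :
    ∫⁻ x, ‖s * φ (s⁻¹ * u x)‖ₑ ∂μ ≤ ENNReal.ofReal s * μ {x | s < |u x|} := by
  refine (lintegral_mono (h.enorm_scaled_le_indicator hs u)).trans ?_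
  rw [lintegral_indicator_const (measurableSet_lt measurable_const (by fun_prop))]

theorem mul_measure_le (h : IsLevelCutoff l B φ) {s : ℝ} (hs : 0 < s) {α : Type*}
    [MeasurableSpace α] {μ : Measure α} {u : α → ℝ} (hu : Measurable u) {p : ℝ} :
    ENNReal.ofReal s ^ p * μ {x | l * s ≤ |u x|} ≤ ∫⁻ x, ‖s * φ (s⁻¹ * u x)‖ₑ ^ p ∂μ := by
  rw [← lintegral_indicator_const (measurableSet_le measurable_const (by fun_prop))]
  refine lintegral_mono fun x => ?_
  rw [indicator_apply]
  split_ifs with hx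
  swap
  · exact bot_le
  have : l ≤ |s⁻¹ * u x| := by
    rw [abs_mul, abs_of_pos (inv_pos.2 hs), le_inv_mul_iff₀ hs, mul_comm]; exact hx
  rw [h.eq_one _ this, mul_one, ← ofReal_norm, Real.norm_of_nonneg hs.le]

end IsLevelCutoff

/-- Global Sobolev inequality for a level slice. -/
theorem sobolev_slice {N : ℕ} (hN : 2 ≤ N) {u : Euc N → ℝ} {g : Euc N → Euc N}
    (hug : HasL1Gradient N u g) (hu : LocallyIntegrable u) {l : ℝ} {B : ℝ≥0∞} {φ : ℝ → ℝ}
    (h : IsLevelCutoff l B φ) {s : ℝ} (hs : 0 < s) :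
    ∫⁻ x, ‖s * φ (s⁻¹ * u x)‖ₑ ^ ((N : ℝ) / ((N : ℝ) - 1)) ≤
      gnsConst N * (∫⁻ x, ‖deriv φ (s⁻¹ * u x)‖ₑ * ‖g x‖ₑ) ^ ((N : ℝ) / ((N : ℝ) - 1)) := by
  obtain ⟨hum, hvan, hg, hweak⟩ := hug
  set p := (N : ℝ) / ((N : ℝ) - 1) with hpdef
  have hp0 : 0 ≤ p := (holderConjugate_critical hN).symm.nonneg
  let ψ : ContDiffBump (0 : Euc N) := ⟨1, 2, one_pos, one_lt_two⟩
  have hψs : ContDiff ℝ 1 ψ := ψ.contDiff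
  obtain ⟨K, hK⟩ := (ψ.hasCompactSupport.fderiv ℝ).exists_bound_of_continuous
    (hψs.continuous_fderiv one_ne_zero)
  set c : ℕ → ℝ := fun n => 1 / ((n : ℝ) + 1) with hc
  have hcpos : ∀ n, 0 < c n := fun n => Nat.one_div_pos_of_nat
  have hclim : Tendsto c atTop (𝓝 0) := tendsto_one_div_add_atTop_nhds_zero_nat (𝕜 := ℝ)
  set m := ∫⁻ x, ‖s * φ (s⁻¹ * u x)‖ₑ with hm
  have hmfin : m ≠ ∞ := ne_top_of_le_ne_top (ENNReal.mul_ne_top ofReal_ne_top (hvan s hs).ne)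
    (h.lintegral_scaled_le hs hum)
  set G := ∫⁻ x, ‖deriv φ (s⁻¹ * u x)‖ₑ * ‖g x‖ₑ with hG
  have hψle : ∀ x, ‖ψ x‖ₑ ≤ 1 := fun x => by
    rw [← ofReal_norm, Real.norm_of_nonneg ψ.nonneg]; exact ofReal_le_one.2 ψ.le_one
  have hstep : ∀ n, ∫⁻ x, ‖ψ (c n • x) * (s * φ (s⁻¹ * u x))‖ₑ ^ p
      ≤ gnsConst N * (G + m * ENNReal.ofReal (c n * K)) ^ p := by
    intro n
    have h1 : ContDiff ℝ 1 (fun x => ψ (c n • x)) := hψs.comp (contDiff_const_smul _)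
    have h2 : HasCompactSupport (fun x => ψ (c n • x)) :=
      ψ.hasCompactSupport.comp_homeomorph (Homeomorph.smulOfNeZero (c n) (hcpos n).ne')
    refine (sobolev_comp_mul hN hum hu hg hweak (h.contDiff_scaled s)
      (B := max B ‖s‖ₑ) (max_lt h.bound_ne_top.lt_top enorm_lt_top).ne
      (fun t => (h.enorm_scaled_le t).trans (le_max_right _ _))
      (fun t => by rw [h.deriv_scaled hs]; exact (h.deriv_le _).trans (le_max_left _ _))
      h1 h2).trans ?_
    gcongr
    · refine lintegral_mono fun x => ?_
      rw [h.deriv_scaled hs]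
      gcongr
      exact mul_le_of_le_one_left' (hψle _)
    · rw [hm, ← lintegral_mul_const' _ _ ofReal_ne_top]
      refine lintegral_mono fun x => ?_
      gcongr
      rw [← ofReal_norm]
      apply ENNReal.ofReal_le_ofReal
      rw [fderiv_comp_smul, norm_smul, Real.norm_of_nonneg (hcpos n).le]
      gcongr
      exact hK _
  have hlim : Tendsto (fun n => gnsConst N * (G + m * ENNReal.ofReal (c n * K)) ^ p) atTop
      (𝓝 (gnsConst N * G ^ p)) := by
    have h1 : Tendsto (fun n => m * ENNReal.ofReal (c n * K)) atTop (𝓝 0) := by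
      have h2 : Tendsto (fun n => ENNReal.ofReal (c n * K)) atTop (𝓝 0) := by
        simpa using ENNReal.tendsto_ofReal (hclim.mul_const K)
      simpa using ENNReal.Tendsto.const_mul h2 (Or.inr hmfin)
    have h3 := (ENNReal.continuous_rpow_const (y := p)).tendsto G
    have h4 : Tendsto (fun n => G + m * ENNReal.ofReal (c n * K)) atTop (𝓝 G) := by
      simpa using tendsto_const_nhds.add h1
    exact ENNReal.Tendsto.const_mul (h3.comp h4) (Or.inr (gnsConst_ne_top N))
  calc ∫⁻ x, ‖s * φ (s⁻¹ * u x)‖ₑ ^ p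
      ≤ ∫⁻ x, liminf (fun n => ‖ψ (c n • x) * (s * φ (s⁻¹ * u x))‖ₑ ^ p) atTop := by
        refine lintegral_mono fun x => ?_
        refine (Tendsto.liminf_eq (tendsto_const_nhds.congr' ?_)).ge
        have h1 : Tendsto (fun n => c n • x) atTop (𝓝 0) := by simpa using hclim.smul_const x
        filter_upwards [h1 (Metric.closedBall_mem_nhds 0 one_pos)] with n hn
        rw [ψ.one_of_mem_closedBall hn, one_mul]
    _ ≤ liminf (fun n => ∫⁻ x, ‖ψ (c n • x) * (s * φ (s⁻¹ * u x))‖ₑ ^ p) atTop := by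
        refine lintegral_liminf_le fun n => ?_
        have h1 : Measurable fun x => ψ (c n • x) :=
          (hψs.continuous.comp (continuous_const_smul (c n))).measurable
        have h2 : Measurable fun x => s * φ (s⁻¹ * u x) :=
          ((h.contDiff_scaled s).continuous.measurable).comp hum
        exact ENNReal.continuous_rpow_const.measurable.comp (h1.mul h2).enorm
    _ ≤ liminf (fun n => gnsConst N * (G + m * ENNReal.ofReal (c n * K)) ^ p) atTop :=
        liminf_le_liminf (Eventually.of_forall hstep)
    _ = gnsConst N * G ^ p := hlim.liminf_eq

theorem lintegral_lintegral_sub_mul {N : ℕ} {a b : Euc N → ℝ≥0∞} (ha : Measurable a)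
    (hb : AEMeasurable b) :
    ∫⁻ y, ∫⁻ x, a (x - y) * b x = (∫⁻ x, a x) * ∫⁻ x, b x := by
  rw [lintegral_lintegral_swap]
  · have : ∀ x, ∫⁻ y, a (x - y) * b x = (∫⁻ y, a y) * b x := fun x => by
      have hm : Measurable fun y => a (x - y) := ha.comp (measurable_const.sub measurable_id)
      rw [lintegral_mul_const _ hm, lintegral_sub_left_eq_self a x]
    simp_rw [this]
    rw [lintegral_const_mul'' _ hb]
  · exact ((ha.comp (measurable_snd.sub measurable_fst)).aemeasurable).mul hb.comp_snd

/-- The averaged localised Sobolev inequality: one power of the gradient norm, the rest paid by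
the supremum `S` of local norms. -/
theorem lintegral_slice_le_of_local_bound {N : ℕ} (hN : 2 ≤ N) {u : Euc N → ℝ}
    {g : Euc N → Euc N} (hug : HasL1Gradient N u g) (hu : LocallyIntegrable u)
    {l : ℝ} {B : ℝ≥0∞} {φ : ℝ → ℝ} (h : IsLevelCutoff l B φ) {s : ℝ} (hs : 0 < s)
    {ψ : Euc N → ℝ} (hψ : ContDiff ℝ 1 ψ) (hψc : HasCompactSupport ψ) {S : ℝ≥0∞} (hSfin : S ≠ ∞)
    (hS : ∀ y, ∫⁻ x, ‖ψ (x - y) * (s * φ (s⁻¹ * u x))‖ₑ ^ ((N : ℝ) / ((N : ℝ) - 1)) ≤ S) :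
    (∫⁻ x, ‖ψ x‖ₑ ^ ((N : ℝ) / ((N : ℝ) - 1))) *
        ∫⁻ x, ‖s * φ (s⁻¹ * u x)‖ₑ ^ ((N : ℝ) / ((N : ℝ) - 1)) ≤
      gnsConst N ^ ((N : ℝ) / ((N : ℝ) - 1))⁻¹ * S ^ ((N : ℝ)⁻¹) *
        ((∫⁻ x, ‖ψ x‖ₑ) * (∫⁻ x, ‖deriv φ (s⁻¹ * u x)‖ₑ * ‖g x‖ₑ)
          + (∫⁻ x, ‖fderiv ℝ ψ x‖ₑ) * ∫⁻ x, ‖s * φ (s⁻¹ * u x)‖ₑ) := by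
  obtain ⟨hum, hvan, hg, hweak⟩ := hug
  set p := (N : ℝ) / ((N : ℝ) - 1) with hpdef
  have hconj := holderConjugate_critical hN
  have hp0 : 0 < p := hconj.symm.pos
  set v : Euc N → ℝ := fun x => s * φ (s⁻¹ * u x) with hv
  have hvm : Measurable v := ((h.contDiff_scaled s).continuous.measurable).comp hum
  set X : Euc N → ℝ≥0∞ := fun y =>
    (∫⁻ x, ‖ψ (x - y)‖ₑ * (‖deriv φ (s⁻¹ * u x)‖ₑ * ‖g x‖ₑ))
      + ∫⁻ x, ‖fderiv ℝ ψ (x - y)‖ₑ * ‖v x‖ₑ with hX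
  have hdm : Measurable fun x => ‖deriv φ (s⁻¹ * u x)‖ₑ :=
    ((h.contDiff.continuous_deriv le_rfl).measurable.comp (hum.const_mul _)).enorm
  have hψm : Measurable fun x => ‖ψ x‖ₑ := hψ.continuous.measurable.enorm
  have hψdm : Measurable fun x => ‖fderiv ℝ ψ x‖ₑ :=
    (hψ.continuous_fderiv one_ne_zero).enorm.measurable
  have hF : ∀ y, ∫⁻ x, ‖ψ (x - y) * v x‖ₑ ^ p ≤ gnsConst N * X y ^ p := by
    intro y
    have h1 : ContDiff ℝ 1 (fun x => ψ (x - y)) := hψ.comp (contDiff_id.sub contDiff_const)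
    have h2 : HasCompactSupport (fun x => ψ (x - y)) :=
      hψc.comp_homeomorph (Homeomorph.subRight y)
    refine (sobolev_comp_mul hN hum hu hg hweak (h.contDiff_scaled s)
      (B := max B ‖s‖ₑ) (max_lt h.bound_ne_top.lt_top enorm_lt_top).ne
      (fun t => (h.enorm_scaled_le t).trans (le_max_right _ _))
      (fun t => by rw [h.deriv_scaled hs]; exact (h.deriv_le _).trans (le_max_left _ _))
      h1 h2).trans (le_of_eq ?_)
    simp only [h.deriv_scaled hs, hX, mul_assoc]
    congr 4 with x
    rw [fderiv_comp_sub, mul_comm]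
  have hFroot : ∀ y, ∫⁻ x, ‖ψ (x - y) * v x‖ₑ ^ p
      ≤ gnsConst N ^ p⁻¹ * S ^ ((N : ℝ)⁻¹) * X y := by
    intro y
    set F := ∫⁻ x, ‖ψ (x - y) * v x‖ₑ ^ p
    calc F = F ^ p⁻¹ * F ^ ((N : ℝ)⁻¹) := by
          rw [← ENNReal.rpow_add_of_nonneg _ _ (inv_nonneg.2 hp0.le) (by positivity),
            hconj.symm.inv_add_inv_eq_one, ENNReal.rpow_one]
      _ ≤ (gnsConst N * X y ^ p) ^ p⁻¹ * S ^ ((N : ℝ)⁻¹) := by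
          gcongr
          · exact hF y
          · exact hS y
      _ = _ := by
          rw [ENNReal.mul_rpow_of_nonneg _ _ (inv_nonneg.2 hp0.le), ← ENNReal.rpow_mul,
            mul_inv_cancel₀ hp0.ne', ENNReal.rpow_one, mul_right_comm]
  have hXm : Measurable fun y => ∫⁻ x, ‖fderiv ℝ ψ (x - y)‖ₑ * ‖v x‖ₑ :=
    Measurable.lintegral_prod_right'
      (f := fun z : Euc N × Euc N => ‖fderiv ℝ ψ (z.2 - z.1)‖ₑ * ‖v z.2‖ₑ)
      ((hψdm.comp (measurable_snd.sub measurable_fst)).mul (hvm.enorm.comp measurable_snd))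
  calc (∫⁻ x, ‖ψ x‖ₑ ^ p) * ∫⁻ x, ‖v x‖ₑ ^ p
      = ∫⁻ y, ∫⁻ x, ‖ψ (x - y) * v x‖ₑ ^ p := by
        rw [← lintegral_lintegral_sub_mul (hψm.pow_const p) (hvm.enorm.pow_const p).aemeasurable]
        simp_rw [enorm_mul, ENNReal.mul_rpow_of_nonneg _ _ hp0.le]
    _ ≤ ∫⁻ y, gnsConst N ^ p⁻¹ * S ^ ((N : ℝ)⁻¹) * X y := lintegral_mono hFroot
    _ ≤ _ := by
      have hb : AEMeasurable fun x => ‖deriv φ (s⁻¹ * u x)‖ₑ * ‖g x‖ₑ :=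
        hdm.aemeasurable.mul hg.1.enorm
      rw [lintegral_const_mul' _ _ (ENNReal.mul_ne_top
        (ENNReal.rpow_ne_top_of_nonneg (inv_nonneg.2 hp0.le) (gnsConst_ne_top N))
        (ENNReal.rpow_ne_top_of_nonneg (by positivity) hSfin)), hX, lintegral_add_right _ hXm,
        lintegral_lintegral_sub_mul hψm hb,
        lintegral_lintegral_sub_mul hψdm hvm.enorm.aemeasurable]

theorem lintegral_comp_smul_of_pos {N : ℕ} (f : Euc N → ℝ≥0∞) {ρ : ℝ} (hρ : 0 < ρ) :
    ∫⁻ x, f (ρ • x) = ENNReal.ofReal (ρ ^ N)⁻¹ * ∫⁻ x, f x := by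
  have h := (Homeomorph.smulOfNeZero ρ hρ.ne' (α := Euc N)).toMeasurableEquiv.measurableEmbedding.lintegral_map
    (μ := volume) f
  have h2 := Measure.map_addHaar_smul (volume : Measure (Euc N)) hρ.ne'
  rw [finrank_euclideanSpace_fin, abs_of_pos (by positivity)] at h2
  calc ∫⁻ x, f (ρ • x) = ∫⁻ x, f x ∂(Measure.map (ρ • ·) volume) := h.symm
    _ = _ := by rw [h2, lintegral_smul_measure, smul_eq_mul]

/-- The supremum of the `L¹` norms on the unit ball of all rescalings of `u`. -/
def localMass (N : ℕ) (u : Euc N → ℝ) : ℝ≥0∞ :=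
  ⨆ (j : ℤ) (y : Euc N), ∫⁻ x in Metric.closedBall 0 1, ‖resc N j y u x‖ₑ

theorem mul_setLIntegral_le_localMass {N : ℕ} (hN : 1 ≤ N) (u : Euc N → ℝ) (j : ℤ) (y : Euc N) :
    ENNReal.ofReal (2 ^ j) * ∫⁻ x in Metric.closedBall y ((2 ^ j)⁻¹), ‖u x‖ₑ ≤ localMass N u := by
  set ρ : ℝ := 2 ^ j with hρdef
  have hρ : 0 < ρ := by positivity
  refine le_trans (le_of_eq ?_) (le_iSup₂ (-j) (-(ρ • y)))
  rw [← lintegral_indicator Metric.isClosed_closedBall.measurableSet,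
    ← lintegral_indicator Metric.isClosed_closedBall.measurableSet]
  set F := (Metric.closedBall y ρ⁻¹).indicator fun x => ‖u x‖ₑ with hF
  have key : ∀ x, (Metric.closedBall (0 : Euc N) 1).indicator
      (fun x => ‖resc N (-j) (-(ρ • y)) u x‖ₑ) x
      = ENNReal.ofReal ((ρ⁻¹) ^ (N - 1)) * F (ρ⁻¹ • (x - -(ρ • y))) := by
    intro x
    have h1 : ρ⁻¹ • (x - -(ρ • y)) = ρ⁻¹ • x + y := by
      rw [sub_neg_eq_add, smul_add, inv_smul_smul₀ hρ.ne']
    have h2 : (2 : ℝ) ^ (((N : ℤ) - 1) * (-j)) = (ρ⁻¹) ^ (N - 1) := by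
      rw [hρdef, ← zpow_neg, ← zpow_natCast, ← zpow_mul, Nat.cast_sub hN, mul_comm]; simp
    have h3 : (x ∈ Metric.closedBall (0 : Euc N) 1) ↔
        ρ⁻¹ • (x - -(ρ • y)) ∈ Metric.closedBall y ρ⁻¹ := by
      rw [h1, mem_closedBall_iff_norm, mem_closedBall_iff_norm, sub_zero, add_sub_cancel_right,
        norm_smul, Real.norm_of_nonneg (inv_nonneg.2 hρ.le),
        mul_le_iff_le_one_right (inv_pos.2 hρ)]
    rw [hF]
    by_cases hx : x ∈ Metric.closedBall (0 : Euc N) 1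
    · rw [indicator_of_mem hx, indicator_of_mem (h3.1 hx), resc, h2, enorm_mul, ← ofReal_norm,
        Real.norm_of_nonneg (by positivity), zpow_neg]
    · rw [indicator_of_notMem hx, indicator_of_notMem (fun h => hx (h3.2 h)), mul_zero]
  simp_rw [key]
  rw [lintegral_const_mul' _ _ ofReal_ne_top,
    lintegral_sub_right_eq_self (fun x => F (ρ⁻¹ • x)) (-(ρ • y)),
    lintegral_comp_smul_of_pos _ (inv_pos.2 hρ), ← mul_assoc,
    ← ENNReal.ofReal_mul (by positivity)]
  congr 2
  obtain ⟨n, rfl⟩ : ∃ n, N = n + 1 := ⟨N - 1, by omega⟩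
  simp only [Nat.add_sub_cancel, inv_pow, pow_succ]
  field_simp

theorem locallyIntegrable_of_localMass_ne_top {N : ℕ} (hN : 1 ≤ N) {u : Euc N → ℝ}
    (hum : Measurable u) (h : localMass N u ≠ ∞) : LocallyIntegrable u := by
  intro x
  refine ⟨Metric.closedBall x 1, Metric.closedBall_mem_nhds x one_pos, hum.aestronglyMeasurable, ?_⟩
  have := mul_setLIntegral_le_localMass hN u 0 x
  simp only [zpow_zero, ofReal_one, inv_one, one_mul] at this
  exact this.trans_lt h.lt_top

/-- The measure of dyadic superlevel sets is controlled by a power of the local mass. -/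
theorem exists_level_bound {N : ℕ} (hN : 2 ≤ N) {C : ℝ≥0∞} (hC : C ≠ ∞) :
    ∃ K : ℝ≥0∞, K ≠ ∞ ∧ ∀ (u : Euc N → ℝ) (g : Euc N → Euc N), HasL1Gradient N u g →
      ∫⁻ x, ‖g x‖ₑ ≤ C → localMass N u ≠ ∞ → ∀ j : ℤ,
      ENNReal.ofReal (((2 : ℝ) ^ j) ^ (N - 1)) ^ ((N : ℝ) / ((N : ℝ) - 1)) *
        volume {x | 2 ^ (N - 1) * ((2 : ℝ) ^ j) ^ (N - 1) ≤ |u x|} ≤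
      K * localMass N u ^ ((N : ℝ)⁻¹) := by
  set p := (N : ℝ) / ((N : ℝ) - 1) with hp
  have hconj := holderConjugate_critical hN
  have hp0 : 0 < p := hconj.symm.pos
  have hp1 : 1 < p := hconj.symm.lt
  set l : ℝ := 2 ^ (N - 1) with hl
  have hl1 : 1 < l := one_lt_pow₀ (by norm_num) (by omega : N - 1 ≠ 0)
  have hl0 : 0 < l := by positivity
  obtain ⟨B, φ, h⟩ := exists_isLevelCutoff hl1
  let ψ : ContDiffBump (0 : Euc N) := ⟨1 / 2, 1, by norm_num, by norm_num⟩
  have hψs : ContDiff ℝ 1 ψ := ψ.contDiff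
  have hψc : HasCompactSupport ψ := ψ.hasCompactSupport
  have hψle : ∀ x, ‖ψ x‖ₑ ≤ 1 := fun x => by
    rw [← ofReal_norm, Real.norm_of_nonneg ψ.nonneg]; exact ofReal_le_one.2 ψ.le_one
  set c₁ := ∫⁻ x, ‖ψ x‖ₑ ^ p with hc₁
  set c₂ := ∫⁻ x, ‖ψ x‖ₑ with hc₂
  set c₃ := ∫⁻ x, ‖fderiv ℝ ψ x‖ₑ with hc₃
  have hc₂t : c₂ ≠ ∞ := (hψs.continuous.integrable_of_hasCompactSupport hψc).2.ne
  have hc₃t : c₃ ≠ ∞ := ((hψs.continuous_fderiv one_ne_zero).integrable_of_hasCompactSupport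
    (hψc.fderiv ℝ)).2.ne
  have hc₁t : c₁ ≠ ∞ := by
    refine ne_top_of_le_ne_top hc₂t (lintegral_mono fun x => ?_)
    exact ENNReal.rpow_le_self_of_le_one (hψle x) hp1.le
  have hc₁0 : c₁ ≠ 0 := by
    intro h0
    rw [hc₁, lintegral_eq_zero_iff
      ((hψs.continuous.measurable.enorm).pow_const p)] at h0
    have h1 : Metric.closedBall (0 : Euc N) (1 / 2) ⊆ {x | ¬ (‖ψ x‖ₑ ^ p = 0)} := fun x hx => by
      rw [mem_ofPred_eq, ψ.one_of_mem_closedBall hx]; simp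
    have h2 := measure_mono_null h1 h0
    exact (Metric.measure_closedBall_pos volume (0 : Euc N) (by norm_num)).ne' h2
  set γ := gnsConst N
  have hγ : γ ≠ ∞ := gnsConst_ne_top N
  set M := c₂ * (B * C) + c₃ * (ENNReal.ofReal l ^ p * (γ * (B * C) ^ p)) with hM
  have hBC : B * C ≠ ∞ := ENNReal.mul_ne_top h.bound_ne_top hC
  have hMt : M ≠ ∞ := ENNReal.add_ne_top.2 ⟨ENNReal.mul_ne_top hc₂t hBC, ENNReal.mul_ne_top hc₃t
    (ENNReal.mul_ne_top (ENNReal.rpow_ne_top_of_nonneg hp0.le ofReal_ne_top)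
      (ENNReal.mul_ne_top hγ (ENNReal.rpow_ne_top_of_nonneg hp0.le hBC)))⟩
  refine ⟨c₁⁻¹ * (γ ^ p⁻¹ * M), ENNReal.mul_ne_top (ENNReal.inv_ne_top.2 hc₁0)
    (ENNReal.mul_ne_top (ENNReal.rpow_ne_top_of_nonneg (inv_nonneg.2 hp0.le) hγ) hMt), ?_⟩
  intro u g hug hgC hθ j
  have hu := locallyIntegrable_of_localMass_ne_top (by omega) hug.1 hθ
  set θ := localMass N u
  set ρ : ℝ := 2 ^ j with hρdef
  have hρ : 0 < ρ := by positivity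
  set s : ℝ := ρ ^ (N - 1) with hs
  have hs0 : 0 < s := by positivity
  have hN1 : ((N - 1 : ℕ) : ℝ) = (N : ℝ) - 1 := by rw [Nat.cast_sub (by omega)]; simp
  have hN0 : (N : ℝ) - 1 ≠ 0 := by
    have : (2 : ℝ) ≤ N := by exact_mod_cast hN
    linarith
  have hsp : s ^ p = ρ ^ N := by
    rw [hs, ← Real.rpow_natCast, ← Real.rpow_mul hρ.le, hN1, hp, mul_div_cancel₀ _ hN0,
      Real.rpow_natCast]
  have hsp1 : s ^ (p - 1) = ρ := by
    rw [hs, ← Real.rpow_natCast, ← Real.rpow_mul hρ.le, hN1, hp]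
    have : ((N : ℝ) - 1) * (N / ((N : ℝ) - 1) - 1) = 1 := by field_simp; ring
    rw [this, Real.rpow_one]
  have hGC : ∀ a : ℝ, ∫⁻ x, ‖deriv φ (a * u x)‖ₑ * ‖g x‖ₑ ≤ B * C := fun a => by
    calc ∫⁻ x, ‖deriv φ (a * u x)‖ₑ * ‖g x‖ₑ ≤ ∫⁻ x, B * ‖g x‖ₑ :=
          lintegral_mono fun x => mul_le_mul_left (h.deriv_le _) _
      _ = B * ∫⁻ x, ‖g x‖ₑ := lintegral_const_mul' _ _ h.bound_ne_top
      _ ≤ B * C := by gcongr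
  -- the cutoff at the scale of the level
  set ψr : Euc N → ℝ := fun x => ψ (ρ • x) with hψr
  have hr1 : ContDiff ℝ 1 ψr := hψs.comp (contDiff_const_smul _)
  have hr2 : HasCompactSupport ψr :=
    hψc.comp_homeomorph (Homeomorph.smulOfNeZero ρ hρ.ne')
  set κ := ENNReal.ofReal (ρ ^ N)⁻¹ with hκ
  have hκ0 : κ ≠ 0 := by rw [hκ]; simp; positivity
  have e1 : ∫⁻ x, ‖ψr x‖ₑ ^ p = κ * c₁ := lintegral_comp_smul_of_pos (fun x => ‖ψ x‖ₑ ^ p) hρ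
  have e2 : ∫⁻ x, ‖ψr x‖ₑ = κ * c₂ := lintegral_comp_smul_of_pos (fun x => ‖ψ x‖ₑ) hρ
  have e3 : ∫⁻ x, ‖fderiv ℝ ψr x‖ₑ = κ * (c₃ * ENNReal.ofReal ρ) := by
    have : ∀ x, ‖fderiv ℝ ψr x‖ₑ = ENNReal.ofReal ρ * ‖fderiv ℝ ψ (ρ • x)‖ₑ := fun x => by
      rw [hψr, fderiv_comp_smul, enorm_smul, ← ofReal_norm ρ, Real.norm_of_nonneg hρ.le]
    simp_rw [this]
    rw [lintegral_const_mul' _ _ ofReal_ne_top,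
      lintegral_comp_smul_of_pos (fun x => ‖fderiv ℝ ψ x‖ₑ) hρ]
    ring
  have hS : ∀ y, ∫⁻ x, ‖ψr (x - y) * (s * φ (s⁻¹ * u x))‖ₑ ^ p ≤ θ := by
    intro y
    refine le_trans ?_ (mul_setLIntegral_le_localMass (by omega) u j y)
    rw [← lintegral_indicator Metric.isClosed_closedBall.measurableSet,
      ← lintegral_const_mul' _ _ ofReal_ne_top]
    refine lintegral_mono fun x => ?_
    by_cases hx : x ∈ Metric.closedBall y ρ⁻¹
    · rw [indicator_of_mem hx]
      have h1 : |ψr (x - y) * (s * φ (s⁻¹ * u x))| ^ p ≤ ρ * |u x| := by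
        have ha : |ψr (x - y) * (s * φ (s⁻¹ * u x))| ≤ s * φ (s⁻¹ * u x) := by
          have h0 : 0 ≤ s * φ (s⁻¹ * u x) := mul_nonneg hs0.le (h.nonneg _)
          rw [abs_of_nonneg (mul_nonneg ψ.nonneg h0)]
          exact mul_le_of_le_one_left h0 ψ.le_one
        have hb : φ (s⁻¹ * u x) ^ p ≤ s⁻¹ * |u x| := by
          refine (Real.rpow_le_self_of_le_one (h.nonneg _) (h.le_one _) hp1.le).trans ?_
          refine (h.le_abs _).trans (le_of_eq ?_)
          rw [abs_mul, abs_of_pos (inv_pos.2 hs0)]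
        calc _ ≤ (s * φ (s⁻¹ * u x)) ^ p := Real.rpow_le_rpow (abs_nonneg _) ha hp0.le
          _ = (ρ * s) * φ (s⁻¹ * u x) ^ p := by
            rw [Real.mul_rpow hs0.le (h.nonneg _), ← hsp1, Real.rpow_sub_one hs0.ne',
              div_mul_cancel₀ _ hs0.ne']
          _ ≤ (ρ * s) * (s⁻¹ * |u x|) := by gcongr
          _ = ρ * |u x| := by field_simp
      calc _ = ENNReal.ofReal (|ψr (x - y) * (s * φ (s⁻¹ * u x))| ^ p) := by
            rw [← ENNReal.ofReal_rpow_of_nonneg (abs_nonneg _) hp0.le, ← Real.norm_eq_abs,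
              ofReal_norm]
        _ ≤ ENNReal.ofReal (ρ * |u x|) := ENNReal.ofReal_le_ofReal h1
        _ = _ := by rw [ENNReal.ofReal_mul hρ.le, ← Real.norm_eq_abs, ofReal_norm]
    · have : ψr (x - y) = 0 := by
        refine ψ.zero_of_le_dist ?_
        rw [dist_zero_right, norm_smul, Real.norm_of_nonneg hρ.le]
        rw [mem_closedBall_iff_norm, not_le] at hx
        have := mul_le_mul_of_nonneg_left hx.le hρ.le
        rwa [mul_inv_cancel₀ hρ.ne'] at this
      rw [this]; simp [hp0]
  have main := lintegral_slice_le_of_local_bound hN hug hu h hs0 hr1 hr2 hθ hS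
  rw [← hp, e1, e2, e3] at main
  set V := ∫⁻ x, ‖s * φ (s⁻¹ * u x)‖ₑ ^ p with hV
  set W := ∫⁻ x, ‖s * φ (s⁻¹ * u x)‖ₑ with hW
  have hWle : ENNReal.ofReal ρ * W ≤ ENNReal.ofReal l ^ p * (γ * (B * C) ^ p) := by
    have hsl : 0 < s / l := by positivity
    calc ENNReal.ofReal ρ * W
        ≤ ENNReal.ofReal ρ * (ENNReal.ofReal s * volume {x | s < |u x|}) := by
          gcongr; exact h.lintegral_scaled_le hs0 hug.1
      _ ≤ ENNReal.ofReal l ^ p * (ENNReal.ofReal (s / l) ^ p *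
          volume {x | l * (s / l) ≤ |u x|}) := by
          rw [← mul_assoc, ← mul_assoc, ← ENNReal.mul_rpow_of_nonneg _ _ hp0.le,
            ← ENNReal.ofReal_mul hρ.le, ← ENNReal.ofReal_mul hl0.le, mul_div_cancel₀ _ hl0.ne',
            ENNReal.ofReal_rpow_of_nonneg hs0.le hp0.le]
          have : ρ * s = s ^ p := by
            nth_rw 1 [← hsp1]; rw [Real.rpow_sub_one hs0.ne', div_mul_cancel₀ _ hs0.ne']
          rw [this]
          gcongr with x
          exact fun hx => le_of_lt hx
      _ ≤ ENNReal.ofReal l ^ p * (γ * (B * C) ^ p) := by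
          refine mul_le_mul_right ?_ _
          refine (h.mul_measure_le hsl hug.1).trans ((sobolev_slice hN hug hu h hsl).trans ?_)
          gcongr
          exact hGC _
  have fin : c₁ * V ≤ γ ^ p⁻¹ * θ ^ ((N : ℝ)⁻¹) * M := by
    refine (ENNReal.mul_le_mul_iff_right hκ0 ofReal_ne_top).1 ?_
    calc κ * (c₁ * V) = κ * c₁ * V := (mul_assoc _ _ _).symm
      _ ≤ _ := main
      _ = κ * (γ ^ p⁻¹ * θ ^ ((N : ℝ)⁻¹) * (c₂ * (∫⁻ x, ‖deriv φ (s⁻¹ * u x)‖ₑ * ‖g x‖ₑ)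
            + c₃ * (ENNReal.ofReal ρ * W))) := by ring
      _ ≤ _ := by
        rw [hM]
        gcongr
        exact hGC _
  calc _ ≤ V := h.mul_measure_le hs0 hug.1
    _ = c₁⁻¹ * (c₁ * V) := by rw [← mul_assoc, ENNReal.inv_mul_cancel hc₁0 hc₁t, one_mul]
    _ ≤ c₁⁻¹ * (γ ^ p⁻¹ * θ ^ ((N : ℝ)⁻¹) * M) := by gcongr
    _ = _ := by ring

/-- A function that is not integrable on the unit ball is, after translation, bounded with
large integral on a compact subset of almost full measure of a given compact set. -/
theorem exists_compact_translate {N : ℕ} {v : Euc N → ℝ} (hv : Measurable v)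
    (hinf : ∫⁻ x in Metric.closedBall 0 1, ‖v x‖ₑ = ∞) {K : Set (Euc N)} (hK : IsCompact K)
    (hKB : K ⊆ Metric.closedBall 0 1) (hK0 : volume K ≠ 0) {δ : ℝ≥0∞} (hδ : δ ≠ 0) :
    ∃ (y : Euc N) (K' : Set (Euc N)) (M : ℕ), IsCompact K' ∧ K' ⊆ K ∧ volume (K \ K') ≤ δ ∧
      (∀ x ∈ K', ‖v (x - y)‖ₑ ≤ M) ∧ 2 ≤ ∫⁻ x in K', ‖v (x - y)‖ₑ := by
  obtain ⟨y, hy⟩ : ∃ y, 3 < ∫⁻ x in K, ‖v (x - y)‖ₑ := by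
    by_contra! hcon
    have h1 : ∫⁻ y in Metric.closedBall (0 : Euc N) 2, ∫⁻ x in K, ‖v (x - y)‖ₑ ≠ ∞ := by
      refine ne_top_of_le_ne_top ?_ (lintegral_mono hcon)
      rw [lintegral_const, Measure.restrict_apply_univ]
      exact ENNReal.mul_ne_top (by simp) measure_closedBall_lt_top.ne
    apply h1
    rw [lintegral_lintegral_swap
      ((hv.comp (measurable_snd.sub measurable_fst)).enorm.aemeasurable)]
    have h2 : ∀ x ∈ K, ∞ ≤ ∫⁻ y in Metric.closedBall (0 : Euc N) 2, ‖v (x - y)‖ₑ := by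
      intro x hx
      rw [← hinf, ← lintegral_indicator Metric.isClosed_closedBall.measurableSet,
        ← lintegral_sub_left_eq_self _ x,
        ← lintegral_indicator Metric.isClosed_closedBall.measurableSet]
      refine lintegral_mono fun y => ?_
      by_cases hy : x - y ∈ Metric.closedBall (0 : Euc N) 1
      · have hy2 : y ∈ Metric.closedBall (0 : Euc N) 2 := by
          have hx1 := hKB hx
          rw [mem_closedBall_zero_iff] at hy hx1 ⊢
          calc ‖y‖ = ‖x - (x - y)‖ := by rw [_root_.sub_sub_cancel]
            _ ≤ ‖x‖ + ‖x - y‖ := norm_sub_le _ _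
            _ ≤ 2 := by linarith
        rw [indicator_of_mem hy, indicator_of_mem hy2]
      · rw [indicator_of_notMem hy]; exact bot_le
    rw [eq_top_iff]
    calc ∞ = ∫⁻ x in K, ∞ := by
          rw [lintegral_const, Measure.restrict_apply_univ, ENNReal.top_mul hK0]
      _ ≤ _ := setLIntegral_mono' hK.measurableSet h2
  set w : Euc N → ℝ := fun x => v (x - y) with hw
  have hwm : Measurable w := hv.comp (measurable_id.sub measurable_const)
  set A : ℕ → Set (Euc N) := fun M => K ∩ {x | ‖w x‖ₑ ≤ M} with hA
  have hAm : ∀ M, MeasurableSet (A M) := fun M =>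
    hK.measurableSet.inter (measurableSet_le hwm.enorm measurable_const)
  have hAmono : Monotone A := fun a b hab x hx =>
    ⟨hx.1, le_trans (b := (a : ℝ≥0∞)) hx.2 (Nat.cast_le.2 hab)⟩
  have hAU : ⋃ M, A M = K := by
    refine Subset.antisymm (iUnion_subset fun M => inter_subset_left) fun x hx => ?_
    obtain ⟨n, hn⟩ := ENNReal.exists_nat_gt (enorm_ne_top (x := w x))
    exact mem_iUnion.2 ⟨n, hx, hn.le⟩
  have hI : ∃ M₁, 3 < ∫⁻ x in A M₁, ‖w x‖ₑ := by
    rw [← hAU, setLIntegral_iUnion_of_directed _ hAmono.directed_le] at hy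
    exact lt_iSup_iff.1 hy
  obtain ⟨M₁, hM₁⟩ := hI
  have hδ2 : δ / 2 ≠ 0 := by simpa using hδ
  have hloss : ∃ M₂, volume (K \ A M₂) < δ / 2 := by
    have h1 := tendsto_measure_iInter_atTop (μ := volume) (s := fun M => K \ A M)
      (fun M => (hK.measurableSet.diff (hAm M)).nullMeasurableSet)
      (fun a b hab => sdiff_subset_sdiff_right (hAmono hab))
      ⟨0, ne_top_of_le_ne_top hK.measure_ne_top (measure_mono sdiff_subset)⟩
    rw [← sdiff_iUnion, hAU, sdiff_self, measure_empty] at h1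
    exact ((tendsto_order.1 h1).2 _ (pos_iff_ne_zero.2 hδ2)).exists
  obtain ⟨M₂, hM₂⟩ := hloss
  set M := max M₁ M₂ with hM
  have hAt : volume (A M) ≠ ∞ := ne_top_of_le_ne_top hK.measure_ne_top
    (measure_mono inter_subset_left)
  obtain ⟨K', hK'A, hK'c, hK'⟩ := (hAm M).exists_isCompact_sdiff_lt hAt
    (ε := min (δ / 2) ((M : ℝ≥0∞) + 1)⁻¹)
    (by rw [← pos_iff_ne_zero, lt_min_iff]; exact ⟨pos_iff_ne_zero.2 hδ2, by simp⟩)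
  refine ⟨y, K', M, hK'c, hK'A.trans inter_subset_left, ?_, fun x hx => (hK'A hx).2, ?_⟩
  · calc volume (K \ K') ≤ volume ((K \ A M) ∪ (A M \ K')) :=
          measure_mono fun x hx => by
            by_cases h : x ∈ A M
            · exact Or.inr ⟨h, hx.2⟩
            · exact Or.inl ⟨hx.1, h⟩
      _ ≤ volume (K \ A M) + volume (A M \ K') := measure_union_le _ _
      _ ≤ δ / 2 + δ / 2 := add_le_add
          ((measure_mono (sdiff_subset_sdiff_right (hAmono (le_max_right _ _)))).trans hM₂.le)
          (hK'.le.trans (min_le_left _ _))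
      _ = δ := ENNReal.add_halves δ
  · have h3 : ∫⁻ x in A M \ K', ‖w x‖ₑ ≤ 1 := by
      calc ∫⁻ x in A M \ K', ‖w x‖ₑ ≤ ∫⁻ x in A M \ K', (M : ℝ≥0∞) :=
            setLIntegral_mono' ((hAm M).diff hK'c.measurableSet) fun x hx => hx.1.2
        _ = M * volume (A M \ K') := by rw [lintegral_const, Measure.restrict_apply_univ]
        _ ≤ (M + 1) * ((M : ℝ≥0∞) + 1)⁻¹ := by
          gcongr
          · exact le_self_add
          · exact hK'.le.trans (min_le_right _ _)
        _ ≤ 1 := ENNReal.mul_inv_le_one _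
    have h4 : ∫⁻ x in A M, ‖w x‖ₑ ≤ (∫⁻ x in K', ‖w x‖ₑ) + 1 := by
      calc ∫⁻ x in A M, ‖w x‖ₑ = ∫⁻ x in K' ∪ A M \ K', ‖w x‖ₑ := by
            rw [union_sdiff_cancel hK'A]
        _ ≤ (∫⁻ x in K', ‖w x‖ₑ) + ∫⁻ x in A M \ K', ‖w x‖ₑ := lintegral_union_le _ _ _
        _ ≤ _ := by gcongr
    have h5 : (2 : ℝ≥0∞) + 1 ≤ (∫⁻ x in K', ‖w x‖ₑ) + 1 := by
      calc (2 : ℝ≥0∞) + 1 = 3 := by norm_num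
        _ ≤ ∫⁻ x in A M₁, ‖w x‖ₑ := hM₁.le
        _ ≤ ∫⁻ x in A M, ‖w x‖ₑ := lintegral_mono_set (hAmono (le_max_left _ _))
        _ ≤ _ := h4
    exact (ENNReal.add_le_add_iff_right one_ne_top).1 h5

/-- For a sequence of functions, a single compact set detects, after translation, every member
that is not integrable on the unit ball. -/
theorem exists_compact_detecting {N : ℕ} {v : ℕ → Euc N → ℝ} (hv : ∀ k, Measurable (v k)) :
    ∃ (K : Set (Euc N)) (y : ℕ → Euc N), IsCompact K ∧
      ∀ k, ∫⁻ x in Metric.closedBall 0 1, ‖v k x‖ₑ = ∞ →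
        1 ≤ ∫⁻ x in K, ‖v k (x - y k)‖ₑ ∧ ∫⁻ x in K, ‖v k (x - y k)‖ₑ ≠ ∞ := by
  let Good : Set (Euc N) × ℝ≥0∞ → Prop := fun σ =>
    IsCompact σ.1 ∧ σ.1 ⊆ Metric.closedBall 0 1 ∧ σ.2 ≠ 0 ∧ σ.2 < volume σ.1
  have step : ∀ k (σ : {σ // Good σ}), ∃ (σ' : {σ // Good σ}) (y : Euc N),
      σ'.1.1 ⊆ σ.1.1 ∧ volume (σ.1.1 \ σ'.1.1) + σ'.1.2 ≤ σ.1.2 ∧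
      (∫⁻ x in Metric.closedBall 0 1, ‖v k x‖ₑ = ∞ → ∃ M : ℕ, (M : ℝ≥0∞) * σ'.1.2 ≤ 1 ∧
        (∀ x ∈ σ'.1.1, ‖v k (x - y)‖ₑ ≤ M) ∧ 2 ≤ ∫⁻ x in σ'.1.1, ‖v k (x - y)‖ₑ) := by
    rintro k ⟨⟨K, δ⟩, hK, hKB, hδ, hδK⟩
    by_cases hb : ∫⁻ x in Metric.closedBall 0 1, ‖v k x‖ₑ = ∞
    · have hδ2 : δ / 2 ≠ 0 := by simpa using hδ
      obtain ⟨y, K', M, hK', hK'K, hl, hM, h2⟩ := exists_compact_translate (hv k) hb hK hKB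
        (bot_le.trans_lt hδK).ne' hδ2
      refine ⟨⟨⟨K', min (δ / 2) ((M : ℝ≥0∞) + 1)⁻¹⟩, hK', hK'K.trans hKB, ?_, ?_⟩, y, hK'K, ?_,
        fun _ => ⟨M, ?_, hM, h2⟩⟩
      · rw [← pos_iff_ne_zero, lt_min_iff]; exact ⟨pos_iff_ne_zero.2 hδ2, by simp⟩
      · refine (min_le_left _ _).trans_lt ?_
        by_contra! hcon
        refine hδK.not_ge ?_
        calc volume K = volume (K' ∪ K \ K') := by rw [union_sdiff_cancel hK'K]
          _ ≤ volume K' + volume (K \ K') := measure_union_le _ _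
          _ ≤ δ / 2 + δ / 2 := add_le_add hcon hl
          _ = δ := ENNReal.add_halves δ
      · calc volume (K \ K') + min (δ / 2) ((M : ℝ≥0∞) + 1)⁻¹ ≤ δ / 2 + δ / 2 :=
              add_le_add hl (min_le_left _ _)
          _ = δ := ENNReal.add_halves δ
      · calc (M : ℝ≥0∞) * min (δ / 2) ((M : ℝ≥0∞) + 1)⁻¹ ≤ (M + 1) * ((M : ℝ≥0∞) + 1)⁻¹ := by
              gcongr
              · exact le_self_add
              · exact min_le_right _ _
          _ ≤ 1 := ENNReal.mul_inv_le_one _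
    · refine ⟨⟨⟨K, δ⟩, hK, hKB, hδ, hδK⟩, 0, Subset.rfl, by simp, fun h => (hb h).elim⟩
  choose next y hsub hloss hbad using step
  have h0 : Good (Metric.closedBall 0 1, volume (Metric.closedBall (0 : Euc N) 1) / 2) := by
    have hp := (Metric.measure_closedBall_pos volume (0 : Euc N) one_pos).ne'
    exact ⟨isCompact_closedBall _ _, Subset.rfl, by simpa using hp,
      ENNReal.half_lt_self hp measure_closedBall_lt_top.ne⟩
  let σ : ℕ → {σ // Good σ} := fun n => Nat.rec ⟨_, h0⟩ (fun k s => next k s) n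
  have hσ : ∀ k, σ (k + 1) = next k (σ k) := fun k => rfl
  have hanti : Antitone fun n => (σ n).1.1 := antitone_nat_of_succ_le fun n => by
    rw [hσ]; exact hsub n (σ n)
  have hacc : ∀ n m, volume ((σ n).1.1 \ (σ (n + m)).1.1) + (σ (n + m)).1.2 ≤ (σ n).1.2 := by
    intro n m
    induction m with
    | zero => simp
    | succ m ih =>
      have h1 := hloss (n + m) (σ (n + m))
      rw [← hσ] at h1
      calc volume ((σ n).1.1 \ (σ (n + (m + 1))).1.1) + (σ (n + (m + 1))).1.2
          ≤ volume ((σ n).1.1 \ (σ (n + m)).1.1)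
              + volume ((σ (n + m)).1.1 \ (σ (n + m + 1)).1.1) + (σ (n + m + 1)).1.2 := by
            gcongr
            · refine (measure_mono fun x hx => ?_).trans (measure_union_le _ _)
              by_cases h : x ∈ (σ (n + m)).1.1
              · exact Or.inr ⟨h, hx.2⟩
              · exact Or.inl ⟨hx.1, h⟩
            · exact le_rfl
        _ ≤ _ := by
          rw [add_assoc]
          exact (add_le_add le_rfl h1).trans ih
  set K := ⋂ n, (σ n).1.1 with hKdef
  have hKc : IsCompact K := by
    refine (σ 0).2.1.of_isClosed_subset (isClosed_iInter fun n => (σ n).2.1.isClosed) ?_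
    exact iInter_subset (fun n => (σ n).1.1) 0
  refine ⟨K, fun k => y k (σ k), hKc, fun k hk => ?_⟩
  obtain ⟨M, hMδ, hM, h2⟩ := hbad k (σ k) hk
  rw [← hσ] at hMδ hM h2
  set w : Euc N → ℝ := fun x => v k (x - y k (σ k))
  have hKsub : K ⊆ (σ (k + 1)).1.1 := iInter_subset (fun n => (σ n).1.1) (k + 1)
  have hlim : volume ((σ (k + 1)).1.1 \ K) ≤ (σ (k + 1)).1.2 := by
    have h1 : (σ (k + 1)).1.1 \ K = ⋃ m, (σ (k + 1)).1.1 \ (σ (k + 1 + m)).1.1 := by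
      ext x
      simp only [hKdef, Set.mem_sdiff, mem_iInter, mem_iUnion, not_forall]
      constructor
      · rintro ⟨hx, n, hn⟩
        exact ⟨n, hx, fun h => hn (hanti (by omega) h)⟩
      · rintro ⟨m, hx, hm⟩
        exact ⟨hx, _, hm⟩
    have h2 : Monotone fun m => (σ (k + 1)).1.1 \ (σ (k + 1 + m)).1.1 := fun a b hab =>
      sdiff_subset_sdiff_right (hanti (by omega))
    rw [h1, h2.measure_iUnion]
    exact iSup_le fun m => le_self_add.trans (hacc (k + 1) m)
  constructor
  · have h3 : ∫⁻ x in (σ (k + 1)).1.1 \ K, ‖w x‖ₑ ≤ 1 := by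
      calc ∫⁻ x in (σ (k + 1)).1.1 \ K, ‖w x‖ₑ ≤ ∫⁻ x in (σ (k + 1)).1.1 \ K, (M : ℝ≥0∞) :=
            setLIntegral_mono' ((σ (k + 1)).2.1.measurableSet.diff hKc.measurableSet)
              fun x hx => hM x hx.1
        _ = M * volume ((σ (k + 1)).1.1 \ K) := by
          rw [lintegral_const, Measure.restrict_apply_univ]
        _ ≤ M * (σ (k + 1)).1.2 := by gcongr
        _ ≤ 1 := hMδ
    have h5 : (1 : ℝ≥0∞) + 1 ≤ (∫⁻ x in K, ‖w x‖ₑ) + 1 := by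
      calc (1 : ℝ≥0∞) + 1 = 2 := by norm_num
        _ ≤ ∫⁻ x in (σ (k + 1)).1.1, ‖w x‖ₑ := h2
        _ = ∫⁻ x in K ∪ (σ (k + 1)).1.1 \ K, ‖w x‖ₑ := by rw [union_sdiff_cancel hKsub]
        _ ≤ (∫⁻ x in K, ‖w x‖ₑ) + ∫⁻ x in (σ (k + 1)).1.1 \ K, ‖w x‖ₑ := lintegral_union_le _ _ _
        _ ≤ _ := by gcongr
    exact (ENNReal.add_le_add_iff_right one_ne_top).1 h5
  · refine ne_top_of_le_ne_top (ENNReal.mul_ne_top (ENNReal.natCast_ne_top M) hKc.measure_ne_top)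
      (b := (M : ℝ≥0∞) * volume K) ?_
    calc ∫⁻ x in K, ‖w x‖ₑ ≤ ∫⁻ x in K, (M : ℝ≥0∞) :=
          setLIntegral_mono' hKc.measurableSet fun x hx => hM x (hKsub hx)
      _ = M * volume K := by rw [lintegral_const, Measure.restrict_apply_univ]

theorem resc_sub {N : ℕ} (j : ℤ) (y z : Euc N) (u : Euc N → ℝ) (x : Euc N) :
    resc N j y u (x - z) = resc N j (y + z) u x := by
  unfold resc
  rw [show x - z - y = x - (y + z) by abel]

theorem measurable_resc {N : ℕ} (j : ℤ) (y : Euc N) {u : Euc N → ℝ} (hu : Measurable u) :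
    Measurable (resc N j y u) := by
  unfold resc
  have h : Measurable fun x : Euc N => (2 : ℝ) ^ j • (x - y) := by fun_prop
  exact (hu.comp h).const_mul _

/-- If all rescaled sequences vanish in `L¹_loc`, then the local masses tend to zero. -/
theorem tendsto_localMass {N : ℕ} {u : ℕ → Euc N → ℝ} (hum : ∀ k, Measurable (u k))
    (hvan : ∀ (j : ℕ → ℤ) (y : ℕ → Euc N) (K : Set (Euc N)), IsCompact K →
      Tendsto (fun k => ∫ x in K, |resc N (j k) (y k) (u k) x|) atTop (𝓝 0)) :
    Tendsto (fun k => localMass N (u k)) atTop (𝓝 0) := by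
  set I : ℕ → ℤ → Euc N → ℝ≥0∞ := fun k j y =>
    ∫⁻ x in Metric.closedBall 0 1, ‖resc N j y (u k) x‖ₑ with hI
  have hint : ∀ (f : Euc N → ℝ) (_ : Measurable f) (K : Set (Euc N)),
      ∫ x in K, |f x| = (∫⁻ x in K, ‖f x‖ₑ).toReal := fun f hf K => by
    simpa using integral_norm_eq_lintegral_enorm (μ := volume.restrict K) hf.aestronglyMeasurable
  have hfin : ∀ᶠ k in atTop, ∀ j y, I k j y ≠ ∞ := by
    have hex : ∀ k, ∃ j y, (∃ j y, I k j y = ∞) → I k j y = ∞ := fun k => by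
      by_cases h : ∃ j y, I k j y = ∞
      · obtain ⟨j, y, hjy⟩ := h
        exact ⟨j, y, fun _ => hjy⟩
      · exact ⟨0, 0, fun h' => (h h').elim⟩
    choose j y hjy using hex
    obtain ⟨K, z, hK, hz⟩ := exists_compact_detecting
      (v := fun k => resc N (j k) (y k) (u k)) (fun k => measurable_resc _ _ (hum k))
    have h1 := hvan j (fun k => y k + z k) K hK
    filter_upwards [(tendsto_order.1 h1).2 1 one_pos] with k hk
    by_contra! hcon
    obtain ⟨h2, h3⟩ := hz k (hjy k hcon)
    simp_rw [resc_sub] at h2 h3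
    rw [hint _ (measurable_resc _ _ (hum k))] at hk
    have := ENNReal.toReal_mono h3 h2
    simp only [toReal_one] at this
    linarith
  have hex : ∀ k, ∃ j y, min 1 (localMass N (u k)) / 2 ≤ I k j y := fun k => by
    by_cases h0 : localMass N (u k) = 0
    · exact ⟨0, 0, by simp [h0]⟩
    · have h1 : min 1 (localMass N (u k)) ≠ 0 := by
        rw [← pos_iff_ne_zero, lt_min_iff]; exact ⟨one_pos, pos_iff_ne_zero.2 h0⟩
      have h2 : min 1 (localMass N (u k)) / 2 < localMass N (u k) :=
        (ENNReal.half_lt_self h1 (ne_top_of_le_ne_top one_ne_top (min_le_left _ _))).trans_le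
          (min_le_right _ _)
      rw [localMass, lt_iSup_iff] at h2
      obtain ⟨j, hj⟩ := h2
      obtain ⟨y, hy⟩ := lt_iSup_iff.1 hj
      exact ⟨j, y, hy.le⟩
  choose j y hjy using hex
  have h1 := hvan j y _ (isCompact_closedBall 0 1)
  have h2 : Tendsto (fun k => I k (j k) (y k)) atTop (𝓝 0) := by
    have h3 := ENNReal.tendsto_ofReal h1
    rw [ofReal_zero] at h3
    refine h3.congr' ?_
    filter_upwards [hfin] with k hk
    rw [hint _ (measurable_resc _ _ (hum k)), ofReal_toReal (hk _ _)]
  have h3 : Tendsto (fun k => 2 * I k (j k) (y k)) atTop (𝓝 0) := by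
    simpa using ENNReal.Tendsto.const_mul h2 (Or.inr (by simp : (2 : ℝ≥0∞) ≠ ∞))
  have h4 : ∀ k, min 1 (localMass N (u k)) ≤ 2 * I k (j k) (y k) := fun k => by
    have := hjy k
    rwa [ENNReal.div_le_iff (by simp) (by simp), mul_comm] at this
  refine tendsto_of_tendsto_of_tendsto_of_le_of_le' tendsto_const_nhds h3
    (Eventually.of_forall fun k => bot_le) ?_
  filter_upwards [(tendsto_order.1 h3).2 1 one_pos] with k hk
  rcases min_le_iff.1 (h4 k) with h | h
  · exact (hk.not_ge h).elim
  · exact h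

/-- The weak Lorentz contribution of the geometric level `l ^ j`. -/
def levelNorm (N : ℕ) (l p : ℝ) (u : Euc N → ℝ) (j : ℤ) : ℝ≥0∞ :=
  ENNReal.ofReal (l ^ j) * volume {x : Euc N | l ^ (j + 1) ≤ |u x|} ^ p⁻¹

theorem rearr_nonneg (N : ℕ) (u : Euc N → ℝ) (t : ℝ) : 0 ≤ rearr N u t :=
  Real.sInf_nonneg fun _ h => h.1.le

theorem exists_level_of_rearr_pos {N : ℕ} {u : Euc N → ℝ} {l t : ℝ} (hl : 1 < l)
    (h : 0 < rearr N u t) : ∃ j : ℤ, rearr N u t ≤ l ^ 2 * l ^ j ∧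
      ENNReal.ofReal t < volume {x : Euc N | l ^ (j + 1) ≤ |u x|} := by
  have hl0 : 0 < l := one_pos.trans hl
  obtain ⟨n, h1, h2⟩ := exists_mem_Ioc_zpow h hl
  refine ⟨n - 1, ?_, ?_⟩
  · rw [← zpow_natCast, ← zpow_add₀ hl0.ne']
    rwa [show ((2 : ℕ) : ℤ) + (n - 1) = n + 1 by push_cast; ring]
  · rw [sub_add_cancel]
    have h3 : ¬ volume {x : Euc N | l ^ n < |u x|} ≤ ENNReal.ofReal t := fun h4 =>
      h1.not_ge (csInf_le ⟨0, fun _ h => h.1.le⟩ ⟨by positivity, h4⟩)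
    exact (not_le.1 h3).trans_le (measure_mono fun x (hx : l ^ n < |u x|) => hx.le)

theorem rpow_mul_rearr_le {N : ℕ} {u : Euc N → ℝ} {l t p : ℝ} (hl : 1 < l) (ht : 0 < t)
    (hp : 0 < p) : ENNReal.ofReal (t ^ (1 / p) * rearr N u t) ≤
      ENNReal.ofReal (l ^ 2) * ⨆ j, levelNorm N l p u j := by
  rcases (rearr_nonneg N u t).eq_or_lt with h | h
  · rw [← h]; simp
  · obtain ⟨j, h1, h2⟩ := exists_level_of_rearr_pos hl h
    calc ENNReal.ofReal (t ^ (1 / p) * rearr N u t)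
        ≤ ENNReal.ofReal (t ^ (1 / p) * (l ^ 2 * l ^ j)) := by gcongr
      _ = ENNReal.ofReal (l ^ 2) * (ENNReal.ofReal (l ^ j) * ENNReal.ofReal t ^ p⁻¹) := by
        rw [ENNReal.ofReal_mul (by positivity), ENNReal.ofReal_mul (by positivity), one_div,
          ENNReal.ofReal_rpow_of_pos ht]
        ring
      _ ≤ ENNReal.ofReal (l ^ 2) * levelNorm N l p u j := by
        unfold levelNorm
        gcongr
      _ ≤ _ := by gcongr; exact le_iSup (levelNorm N l p u) j

theorem lorentz_top_le {N : ℕ} {u : Euc N → ℝ} {l p : ℝ} (hl : 1 < l) (hp : 0 < p) :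
    lorentz N p ∞ u ≤ ENNReal.ofReal (l ^ 2) * ⨆ j, levelNorm N l p u j := by
  rw [lorentz, if_pos rfl]
  exact iSup₂_le fun t ht => rpow_mul_rearr_le hl ht hp

theorem lintegral_rpow_sub_one_le {p : ℝ} (hp : 0 < p) (m : ℝ≥0∞) :
    ∫⁻ t in Ioi (0 : ℝ), {t | ENNReal.ofReal t < m}.indicator
      (fun t => ENNReal.ofReal (t ^ (p⁻¹ - 1))) t ≤ ENNReal.ofReal p * m ^ p⁻¹ := by
  have hp' : 0 < p⁻¹ := inv_pos.2 hp
  rcases eq_or_ne m ∞ with rfl | hm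
  · rw [ENNReal.top_rpow_of_pos hp', ENNReal.mul_top (by simpa using hp)]
    exact le_top
  have hM : 0 ≤ m.toReal := toReal_nonneg
  have hint : IntervalIntegrable (fun t : ℝ => t ^ (p⁻¹ - 1)) volume 0 m.toReal :=
    intervalIntegral.intervalIntegrable_rpow' (by linarith)
  rw [intervalIntegrable_iff_integrableOn_Ioc_of_le hM] at hint
  calc _ ≤ ∫⁻ t in Ioi (0 : ℝ), (Ioc 0 m.toReal).indicator
          (fun t => ENNReal.ofReal (t ^ (p⁻¹ - 1))) t := by
        refine setLIntegral_mono' measurableSet_Ioi fun t ht => ?_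
        by_cases h : t ∈ {t | ENNReal.ofReal t < m}
        · have h2 : t ∈ Ioc 0 m.toReal := ⟨ht, ((ENNReal.ofReal_lt_iff_lt_toReal (le_of_lt ht) hm).1 h).le⟩
          rw [indicator_of_mem h, indicator_of_mem h2]
        · rw [indicator_of_notMem h]; exact bot_le
    _ ≤ ∫⁻ t, (Ioc 0 m.toReal).indicator (fun t => ENNReal.ofReal (t ^ (p⁻¹ - 1))) t :=
        setLIntegral_le_lintegral _ _
    _ = ∫⁻ t in Ioc 0 m.toReal, ENNReal.ofReal (t ^ (p⁻¹ - 1)) :=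
        lintegral_indicator measurableSet_Ioc _
    _ = ENNReal.ofReal (∫ t in Ioc 0 m.toReal, t ^ (p⁻¹ - 1)) := by
        rw [ofReal_integral_eq_lintegral_ofReal hint]
        filter_upwards [ae_restrict_mem measurableSet_Ioc] with t ht
        exact Real.rpow_nonneg ht.1.le _
    _ = ENNReal.ofReal (p * m.toReal ^ p⁻¹) := by
        rw [← intervalIntegral.integral_of_le hM, integral_rpow (Or.inl (by linarith)),
          sub_add_cancel, Real.zero_rpow hp'.ne', sub_zero, div_inv_eq_mul, mul_comm]
    _ = ENNReal.ofReal p * m ^ p⁻¹ := by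
        rw [ENNReal.ofReal_mul hp.le, ← ENNReal.ofReal_rpow_of_nonneg hM hp'.le, ofReal_toReal hm]

theorem lintegral_rearr_le_tsum {N : ℕ} {u : Euc N → ℝ} {l p : ℝ} (hl : 1 < l) (hp : 0 < p) :
    ∫⁻ t in Ioi (0 : ℝ), ENNReal.ofReal (t ^ (1 / p) * rearr N u t / t) ≤
      ENNReal.ofReal (l ^ 2) * ENNReal.ofReal p * ∑' j, levelNorm N l p u j := by
  set m : ℤ → ℝ≥0∞ := fun j => volume {x : Euc N | l ^ (j + 1) ≤ |u x|} with hm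
  set f : ℤ → ℝ → ℝ≥0∞ := fun j => {t | ENNReal.ofReal t < m j}.indicator
      (fun t => ENNReal.ofReal (t ^ (p⁻¹ - 1))) with hf
  have hl0 : 0 < l := one_pos.trans hl
  have hfm : ∀ j, Measurable (f j) := fun j =>
    Measurable.indicator (by fun_prop) (measurableSet_lt (by fun_prop) measurable_const)
  calc _ ≤ ∫⁻ t in Ioi (0 : ℝ), ∑' j, ENNReal.ofReal (l ^ 2 * l ^ j) * f j t := by
        refine setLIntegral_mono' measurableSet_Ioi fun t (ht : 0 < t) => ?_
        rcases (rearr_nonneg N u t).eq_or_lt with h | h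
        · rw [← h]; simp
        · obtain ⟨j, h1, h2⟩ := exists_level_of_rearr_pos hl h
          refine le_trans ?_ (ENNReal.le_tsum j)
          have h3 : f j t = ENNReal.ofReal (t ^ (p⁻¹ - 1)) := indicator_of_mem (s := {t | ENNReal.ofReal t < m j}) h2 _
          rw [h3, ← ENNReal.ofReal_mul (by positivity)]
          apply ENNReal.ofReal_le_ofReal
          rw [mul_div_right_comm, one_div, Real.rpow_sub_one ht.ne', mul_comm]
          gcongr
    _ = ∑' j, ∫⁻ t in Ioi (0 : ℝ), ENNReal.ofReal (l ^ 2 * l ^ j) * f j t :=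
        lintegral_tsum fun j => ((hfm j).const_mul _).aemeasurable
    _ ≤ ∑' j, ENNReal.ofReal (l ^ 2) * ENNReal.ofReal p * levelNorm N l p u j := by
        refine ENNReal.tsum_le_tsum fun j => ?_
        rw [lintegral_const_mul' _ _ ofReal_ne_top]
        calc _ ≤ ENNReal.ofReal (l ^ 2 * l ^ j) * (ENNReal.ofReal p * m j ^ p⁻¹) := by
              gcongr
              exact lintegral_rpow_sub_one_le hp _
          _ = _ := by
              rw [ENNReal.ofReal_mul (by positivity), levelNorm]
              ring
    _ = _ := ENNReal.tsum_mul_left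

theorem lorentz_le_of_ne_top {N : ℕ} {u : Euc N → ℝ} {l p : ℝ} {q : ℝ≥0∞} (hl : 1 < l)
    (hp : 0 < p) (hq : 1 < q) (hqt : q ≠ ∞) (hsup : ⨆ j, levelNorm N l p u j ≠ ∞) :
    lorentz N p q u ≤ ((ENNReal.ofReal (l ^ 2) * ⨆ j, levelNorm N l p u j) ^ (q.toReal - 1) *
      (ENNReal.ofReal (l ^ 2) * ENNReal.ofReal p * ∑' j, levelNorm N l p u j)) ^
        (1 / q.toReal) := by
  have hq1 : 1 < q.toReal := by simpa using (ENNReal.toReal_lt_toReal one_ne_top hqt).2 hq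
  rw [lorentz, if_neg hqt]
  refine ENNReal.rpow_le_rpow ?_ (by positivity)
  set E := ENNReal.ofReal (l ^ 2) * ⨆ j, levelNorm N l p u j with hE
  have hEt : E ≠ ∞ := ENNReal.mul_ne_top ofReal_ne_top hsup
  calc _ ≤ ∫⁻ t in Ioi (0 : ℝ), E ^ (q.toReal - 1) *
          ENNReal.ofReal (t ^ (1 / p) * rearr N u t / t) := by
        refine setLIntegral_mono' measurableSet_Ioi fun t (ht : 0 < t) => ?_
        set a := t ^ (1 / p) * rearr N u t with ha
        have ha0 : 0 ≤ a := mul_nonneg (by positivity) (rearr_nonneg N u t)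
        have h1 : a ^ q.toReal / t = a ^ (q.toReal - 1) * (a / t) := by
          rw [← mul_div_assoc, ← Real.rpow_add_one' ha0 (by linarith), sub_add_cancel]
        rw [h1, ENNReal.ofReal_mul (by positivity),
          ← ENNReal.ofReal_rpow_of_nonneg ha0 (by linarith)]
        have h2 : ENNReal.ofReal a ≤ E := rpow_mul_rearr_le hl ht hp
        gcongr
    _ = E ^ (q.toReal - 1) * ∫⁻ t in Ioi (0 : ℝ), ENNReal.ofReal (t ^ (1 / p) * rearr N u t / t) :=
        lintegral_const_mul' _ _ (ENNReal.rpow_ne_top_of_nonneg (by linarith) hEt)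
    _ ≤ _ := by
        gcongr
        exact lintegral_rearr_le_tsum hl hp

/-- The derivatives of a level cutoff at geometric scales have disjoint supports. -/
theorem IsLevelCutoff.tsum_deriv_le {l : ℝ} {B : ℝ≥0∞} {φ : ℝ → ℝ} (h : IsLevelCutoff l B φ)
    (hl : 1 < l) (t : ℝ) : ∑' j : ℤ, ‖deriv φ ((l ^ j)⁻¹ * t)‖ₑ ≤ B := by
  have hl0 : 0 < l := one_pos.trans hl
  have key : ∀ j : ℤ, deriv φ ((l ^ j)⁻¹ * t) ≠ 0 → l ^ j < |t| ∧ |t| < l ^ (j + 1) := by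
    intro j hj
    have hpos : 0 < l ^ j := zpow_pos hl0 j
    have h1 : ¬ (|(l ^ j)⁻¹ * t| ≤ 1 ∨ l ≤ |(l ^ j)⁻¹ * t|) := fun h' => hj (h.deriv_eq_zero _ h')
    rw [abs_mul, abs_of_pos (inv_pos.2 hpos), not_or, not_le, not_le] at h1
    rw [lt_inv_mul_iff₀ hpos, inv_mul_lt_iff₀ hpos, mul_one] at h1
    rwa [zpow_add_one₀ hl0.ne']
  by_cases hex : ∃ j : ℤ, deriv φ ((l ^ j)⁻¹ * t) ≠ 0
  · obtain ⟨i, hi⟩ := hex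
    rw [tsum_eq_single i]
    · exact h.deriv_le _
    · intro j hji
      by_contra hj
      have hj' : deriv φ ((l ^ j)⁻¹ * t) ≠ 0 := fun h0 => hj (by rw [h0]; simp)
      obtain ⟨a1, a2⟩ := key i hi
      obtain ⟨b1, b2⟩ := key j hj'
      have c1 := (zpow_lt_zpow_iff_right₀ hl).1 (a1.trans b2)
      have c2 := (zpow_lt_zpow_iff_right₀ hl).1 (b1.trans a2)
      omega
  · push Not at hex
    simp [hex]

/-- The Lorentz `L^{1*,1}` estimate, in discrete form. -/
theorem exists_tsum_levelNorm_le {N : ℕ} (hN : 2 ≤ N) {l : ℝ} (hl : 1 < l) {C : ℝ≥0∞}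
    (hC : C ≠ ∞) : ∃ A : ℝ≥0∞, A ≠ ∞ ∧ ∀ (u : Euc N → ℝ) (g : Euc N → Euc N),
      HasL1Gradient N u g → LocallyIntegrable u → ∫⁻ x, ‖g x‖ₑ ≤ C →
      ∑' j, levelNorm N l ((N : ℝ) / ((N : ℝ) - 1)) u j ≤ A := by
  set p := (N : ℝ) / ((N : ℝ) - 1) with hp
  have hp0 : 0 < p := (holderConjugate_critical hN).symm.pos
  have hp0' : 0 ≤ p⁻¹ := inv_nonneg.2 hp0.le
  have hl0 : 0 < l := one_pos.trans hl
  obtain ⟨B, φ, h⟩ := exists_isLevelCutoff hl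
  refine ⟨gnsConst N ^ p⁻¹ * (B * C), ENNReal.mul_ne_top
    (ENNReal.rpow_ne_top_of_nonneg hp0' (gnsConst_ne_top N))
    (ENNReal.mul_ne_top h.bound_ne_top hC), fun u g hug hu hg => ?_⟩
  have hle : ∀ j : ℤ, levelNorm N l p u j ≤
      gnsConst N ^ p⁻¹ * ∫⁻ x, ‖deriv φ ((l ^ j)⁻¹ * u x)‖ₑ * ‖g x‖ₑ := by
    intro j
    have hpos : 0 < l ^ j := zpow_pos hl0 j
    have h1 := (h.mul_measure_le (p := p) hpos hug.1).trans (sobolev_slice hN hug hu h hpos)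
    have h2 := ENNReal.rpow_le_rpow h1 hp0'
    rw [ENNReal.mul_rpow_of_nonneg _ _ hp0', ENNReal.mul_rpow_of_nonneg _ _ hp0',
      ← ENNReal.rpow_mul, ← ENNReal.rpow_mul, mul_inv_cancel₀ hp0.ne', ENNReal.rpow_one,
      ENNReal.rpow_one] at h2
    rwa [levelNorm, zpow_add_one₀ hl0.ne', mul_comm (l ^ j) l]
  have hm : ∀ j : ℤ, AEMeasurable fun x => ‖deriv φ ((l ^ j)⁻¹ * u x)‖ₑ * ‖g x‖ₑ := fun j =>
    ((h.contDiff.continuous_deriv le_rfl).measurable.comp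
      (hug.1.const_mul _)).enorm.aemeasurable.mul hug.2.2.1.1.enorm
  calc _ ≤ ∑' j : ℤ, gnsConst N ^ p⁻¹ * ∫⁻ x, ‖deriv φ ((l ^ j)⁻¹ * u x)‖ₑ * ‖g x‖ₑ :=
        ENNReal.tsum_le_tsum hle
    _ = gnsConst N ^ p⁻¹ * ∫⁻ x, ∑' j : ℤ, ‖deriv φ ((l ^ j)⁻¹ * u x)‖ₑ * ‖g x‖ₑ := by
        rw [ENNReal.tsum_mul_left, lintegral_tsum hm]
    _ ≤ gnsConst N ^ p⁻¹ * ∫⁻ x, B * ‖g x‖ₑ := by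
        gcongr with x
        rw [ENNReal.tsum_mul_right]
        gcongr
        exact h.tsum_deriv_le hl _
    _ ≤ _ := by
        rw [lintegral_const_mul' _ _ h.bound_ne_top]
        gcongr

/-- cocompactness of `Ẇ^{1,1}(ℝ^N) ↪ L^{1*,q}(ℝ^N)`, `1 < q ≤ ∞`,
with respect to the rescaling group `D`. -/
theorem cocompact_W11_into_Lorentz
    (N : ℕ) (hN : 2 ≤ N) (q : ℝ≥0∞) (hq : 1 < q)
    (u : ℕ → Euc N → ℝ) (g : ℕ → Euc N → Euc N)
    (hmem : ∀ k, HasL1Gradient N (u k) (g k))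
    (hbdd : ∃ C : ℝ, ∀ k, ∫ x, ‖g k x‖ ≤ C)
    (hvan : ∀ (j : ℕ → ℤ) (y : ℕ → Euc N),
      WeakBVconv N (fun k => resc N (j k) (y k) (u k)) 0) :
    Tendsto (fun k => lorentz N ((N : ℝ) / ((N : ℝ) - 1)) q (u k)) atTop (𝓝 0) := by
  obtain ⟨C, hC⟩ := hbdd
  set p := (N : ℝ) / ((N : ℝ) - 1) with hp
  have hp0 : 0 < p := (holderConjugate_critical hN).symm.pos
  have hgC : ∀ k, ∫⁻ x, ‖g k x‖ₑ ≤ ENNReal.ofReal C := fun k => by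
    rw [← ofReal_integral_norm_eq_lintegral_enorm (hmem k).2.2.1]
    exact ENNReal.ofReal_le_ofReal (hC k)
  set l : ℝ := 2 ^ (N - 1) with hl
  have hl1 : 1 < l := one_lt_pow₀ (by norm_num) (by omega : N - 1 ≠ 0)
  have hl0 : 0 < l := one_pos.trans hl1
  have hθ : Tendsto (fun k => localMass N (u k)) atTop (𝓝 0) :=
    tendsto_localMass (fun k => (hmem k).1) fun j y K hK => by
      simpa using (hvan j y).1 K hK
  have hfin : ∀ᶠ k in atTop, localMass N (u k) ≠ ∞ := by
    filter_upwards [(tendsto_order.1 hθ).2 1 one_pos] with k hk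
    exact (hk.trans one_lt_top).ne
  obtain ⟨K, hKt, hK⟩ := exists_level_bound hN (ofReal_ne_top (r := C))
  obtain ⟨A, hAt, hA⟩ := exists_tsum_levelNorm_le hN hl1 (ofReal_ne_top (r := C))
  set ε : ℕ → ℝ≥0∞ := fun k => (K * localMass N (u k) ^ ((N : ℝ)⁻¹)) ^ p⁻¹ with hε
  have hNinv : 0 < (N : ℝ)⁻¹ := inv_pos.2 (by exact_mod_cast (by omega : 0 < N))
  have hεlim : Tendsto ε atTop (𝓝 0) := by
    have h1 := ((ENNReal.continuous_rpow_const (y := (N : ℝ)⁻¹)).tendsto 0).comp hθ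
    rw [ENNReal.zero_rpow_of_pos hNinv] at h1
    have h2 := ENNReal.Tendsto.const_mul h1 (Or.inr hKt)
    rw [mul_zero] at h2
    have h3 := ((ENNReal.continuous_rpow_const (y := p⁻¹)).tendsto 0).comp h2
    rwa [ENNReal.zero_rpow_of_pos (inv_pos.2 hp0)] at h3
  have hsup : ∀ᶠ k in atTop, ⨆ j, levelNorm N l p (u k) j ≤ ε k := by
    filter_upwards [hfin] with k hk
    refine iSup_le fun j => ?_
    have h1 := ENNReal.rpow_le_rpow (hK (u k) (g k) (hmem k) (hgC k) hk j) (inv_nonneg.2 hp0.le)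
    have h2 : ((2 : ℝ) ^ j) ^ (N - 1) = l ^ j := by
      rw [hl, ← zpow_natCast, ← zpow_natCast, ← zpow_mul, ← zpow_mul, mul_comm]
    rw [ENNReal.mul_rpow_of_nonneg _ _ (inv_nonneg.2 hp0.le), ← ENNReal.rpow_mul,
      mul_inv_cancel₀ hp0.ne', ENNReal.rpow_one, h2, mul_comm _ (l ^ j)] at h1
    rwa [levelNorm, zpow_add_one₀ hl0.ne']
  have hElim : Tendsto (fun k => ENNReal.ofReal (l ^ 2) * ε k) atTop (𝓝 0) := by
    simpa using ENNReal.Tendsto.const_mul hεlim (Or.inr (ofReal_ne_top (r := l ^ 2)))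
  by_cases hqt : q = ∞
  · subst hqt
    refine tendsto_of_tendsto_of_tendsto_of_le_of_le' tendsto_const_nhds hElim
      (Eventually.of_forall fun k => bot_le) ?_
    filter_upwards [hsup] with k hk
    exact (lorentz_top_le hl1 hp0).trans (by gcongr)
  · have hq1 : 1 < q.toReal := by simpa using (ENNReal.toReal_lt_toReal one_ne_top hqt).2 hq
    set D := ENNReal.ofReal (l ^ 2) * ENNReal.ofReal p * A with hD
    have hDt : D ≠ ∞ := ENNReal.mul_ne_top (ENNReal.mul_ne_top ofReal_ne_top ofReal_ne_top) hAt
    have hlim : Tendsto (fun k => ((ENNReal.ofReal (l ^ 2) * ε k) ^ (q.toReal - 1) * D) ^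
        (1 / q.toReal)) atTop (𝓝 0) := by
      have h1 := ((ENNReal.continuous_rpow_const (y := q.toReal - 1)).tendsto 0).comp hElim
      rw [ENNReal.zero_rpow_of_pos (by linarith)] at h1
      have h2 := ENNReal.Tendsto.mul_const h1 (Or.inr hDt)
      rw [zero_mul] at h2
      have h3 := ((ENNReal.continuous_rpow_const (y := 1 / q.toReal)).tendsto 0).comp h2
      rwa [ENNReal.zero_rpow_of_pos (by positivity)] at h3
    refine tendsto_of_tendsto_of_tendsto_of_le_of_le' tendsto_const_nhds hlim
      (Eventually.of_forall fun k => bot_le) ?_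
    filter_upwards [hsup, hfin, (tendsto_order.1 hεlim).2 1 one_pos] with k hk hkf hk1
    refine (lorentz_le_of_ne_top hl1 hp0 hq hqt
      (ne_top_of_le_ne_top (hk1.trans one_lt_top).ne hk)).trans ?_
    have h1 : ∑' j, levelNorm N l p (u k) j ≤ A := hA (u k) (g k) (hmem k)
      (locallyIntegrable_of_localMass_ne_top (by omega) (hmem k).1 hkf) (hgC k)
    rw [hD]
    gcongr
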